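/- arXiv:2111.12387 — 3 statements merged into one kernel-verified Lean document; each statement's English description precedes it below -/
import Mathlib

section
/- Let D = (V, A) be a directed acyclic graph. The acyclic reorientation poset AR(D) is a lattice (every pair of elements has a least upper bound and a greatest lower bound) if and only if D is vertebrate. -/
def ArcRel {V : Type*} (E : Set (V × V)) : V → V → Prop := fun x y => (x, y) ∈ E

/-- `E` has no directed cycle. -/
def AcyclicArcs {V : Type*} (E : Set (V × V)) : Prop :=
  ∀ v : V, ¬ Relation.TransGen (ArcRel E) v v

/-- `A` is the arc set of a directed acyclic graph: arcs join distinct vertices,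
at most one direction between two vertices, and no directed cycle. -/
def IsDAG {V : Type*} (A : Set (V × V)) : Prop :=
  (∀ a ∈ A, a.1 ≠ a.2) ∧ (∀ a ∈ A, Prod.swap a ∉ A) ∧ AcyclicArcs A

/-- Arc set of the reorientation of `A` where exactly the arcs of `B` are reversed. -/
def reorient {V : Type*} (A B : Set (V × V)) : Set (V × V) :=
  (A \ B) ∪ (Prod.swap '' B)

/-- `B` encodes an acyclic reorientation of `A`. -/
def ARmem {V : Type*} (A B : Set (V × V)) : Prop :=
  B ⊆ A ∧ AcyclicArcs (reorient A B)

/-- The acyclic reorientation poset of `A`, ordered by inclusion of reversed sets. -/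
abbrev ARP {V : Type*} (A : Set (V × V)) := {B : Set (V × V) // ARmem A B}

/-- Transitive reduction: delete every arc whose endpoints are joined by a
directed path of length at least 2. -/
def transRed {V : Type*} (E : Set (V × V)) : Set (V × V) :=
  {a ∈ E | ¬ ∃ w : V, ArcRel E a.1 w ∧ Relation.TransGen (ArcRel E) w a.2}

/-- Underlying undirected graph of an arc set. -/
def undirectedGraph {V : Type*} (E : Set (V × V)) : SimpleGraph V :=
  SimpleGraph.fromRel (fun x y => (x, y) ∈ E)

/-- A directed graph is a forest if its underlying undirected graph has no cycle. -/
def IsForestArcs {V : Type*} (E : Set (V × V)) : Prop :=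
  (undirectedGraph E).IsAcyclic

def inducedArcs {V : Type*} (A : Set (V × V)) (U : Set V) : Set (V × V) :=
  {a ∈ A | a.1 ∈ U ∧ a.2 ∈ U}

/-- The transitive reduction of any induced subgraph is a forest. -/
def Vertebrate {V : Type*} (A : Set (V × V)) : Prop :=
  ∀ U : Set V, IsForestArcs (transRed (inducedArcs A U))

open Relation

theorem tg_mono {V : Type*} {r s : V → V → Prop} (h : ∀ x y, r x y → s x y) {a b : V}
    (hab : TransGen r a b) : TransGen s a b :=
  TransGen.mono h a b hab

theorem path_of_tg {V : Type*} {r : V → V → Prop} {a b : V} (h : TransGen r a b) :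
    ∃ (n : ℕ) (p : ℕ → V), 1 ≤ n ∧ p 0 = a ∧ p n = b ∧ ∀ i < n, r (p i) (p (i+1)) := by
  induction h using TransGen.head_induction_on with
  | single h =>
    rename_i a
    refine ⟨1, fun i => if i = 0 then a else b, le_rfl, by simp, by simp, ?_⟩
    intro i hi
    have : i = 0 := by omega
    subst this
    simpa using h
  | @head a' c h _ ih =>
    obtain ⟨n, p, hn, h0, h1, h2⟩ := ih
    refine ⟨n+1, fun i => Nat.casesOn i a' p, by omega, rfl, h1, ?_⟩
    intro i hi
    cases i with
    | zero => simpa [h0] using h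
    | succ i => exact h2 i (by omega)

theorem tg_of_path {V : Type*} {r : V → V → Prop} {n : ℕ} {p : ℕ → V}
    (h : ∀ i < n, r (p i) (p (i+1))) {i j : ℕ} (hij : i < j) (hj : j ≤ n) :
    TransGen r (p i) (p j) := by
  induction j, hij using Nat.le_induction with
  | base => exact .single (h i (by omega))
  | succ k hk ih => exact (ih (by omega)).tail (h k (by omega))

theorem ar_compl {V : Type*} {A B : Set (V × V)} (h : ARmem A B) : ARmem A (A \ B) := by
  refine ⟨Set.diff_subset, fun v hv => h.2 v ?_⟩
  have : TransGen (Function.swap (ArcRel (reorient A B))) v v := by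
    refine tg_mono ?_ hv
    rintro x y (⟨h1, h2⟩ | ⟨⟨a, b⟩, ⟨h1, h2⟩, h3⟩)
    · right
      refine ⟨(x, y), ?_, rfl⟩
      by_contra h3
      exact h2 ⟨h1, h3⟩
    · simp only [Prod.swap, Prod.mk.injEq] at h3
      obtain ⟨rfl, rfl⟩ := h3
      exact Or.inl ⟨h1, h2⟩
  exact transGen_swap.1 this

theorem ar_empty {V : Type*} {A : Set (V × V)} (h : AcyclicArcs A) : ARmem A ∅ := by
  refine ⟨Set.empty_subset _, ?_⟩
  simpa [reorient] using h

theorem ar_single {V : Type*} {E : Set (V × V)} (h : AcyclicArcs E) {f : V × V}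
    (hf : f ∈ transRed E) : ARmem E {f} := by
  obtain ⟨a, b⟩ := f
  obtain ⟨hE, ht⟩ := hf
  refine ⟨by simpa using hE, fun v hv => ?_⟩
  have key : ∀ x y, TransGen (ArcRel (reorient E {(a,b)})) x y →
      TransGen (ArcRel (E \ {(a,b)})) x y ∨
      (ReflTransGen (ArcRel (E \ {(a,b)})) x b ∧ ReflTransGen (ArcRel (E \ {(a,b)})) a y) := by
    have step : ∀ y z, ArcRel (reorient E {(a,b)}) y z →
        ArcRel (E \ {(a,b)}) y z ∨ (y = b ∧ z = a) := by
      rintro y z (h1 | ⟨c, h1, h2⟩)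
      · exact Or.inl h1
      · right
        rw [Set.mem_singleton_iff] at h1
        subst h1
        simp only [Prod.swap, Prod.mk.injEq] at h2
        exact ⟨h2.1.symm, h2.2.symm⟩
    intro x y hxy
    induction hxy with
    | single h1 =>
      rcases step _ _ h1 with h2 | ⟨rfl, rfl⟩
      · exact Or.inl (.single h2)
      · exact Or.inr ⟨.refl, .refl⟩
    | tail _ h1 ih =>
      rcases step _ _ h1 with h2 | ⟨rfl, rfl⟩
      · rcases ih with ih | ih
        · exact Or.inl (ih.tail h2)
        · exact Or.inr ⟨ih.1, ih.2.tail h2⟩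
      · rcases ih with ih | ih
        · exact Or.inr ⟨ih.to_reflTransGen, .refl⟩
        · exact Or.inr ⟨ih.1, .refl⟩
  have mono : ∀ x y, ArcRel (E \ {(a,b)}) x y → ArcRel E x y := fun x y h => h.1
  rcases key v v hv with h1 | ⟨h1, h2⟩
  · exact h v (tg_mono mono h1)
  · have h3 := h2.trans h1
    rcases ReflTransGen.cases_head h3 with h4 | ⟨w, h4, h5⟩
    · have h4 : a = b := h4
      subst h4
      exact h a (.single hE)
    · apply ht
      refine ⟨w, h4.1, ?_⟩
      rcases reflTransGen_iff_eq_or_transGen.1 h5 with h6 | h6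
      · subst h6
        exact absurd rfl h4.2
      · exact tg_mono mono h6

/-- arcs entering `U` -/
def entering {V : Type*} (A : Set (V × V)) (U : Set V) : Set (V × V) :=
  {a ∈ A | a.1 ∉ U ∧ a.2 ∈ U}

theorem ar_lift {V : Type*} {A : Set (V × V)} (h : AcyclicArcs A) {U : Set V} {x : Set (V × V)}
    (hx : ARmem (inducedArcs A U) x) : ARmem A (entering A U ∪ x) := by
  have hxA : ∀ a ∈ x, a ∈ A ∧ a.1 ∈ U ∧ a.2 ∈ U := fun a ha => hx.1 ha
  refine ⟨?_, fun v hv => ?_⟩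
  · rintro a (ha | ha)
    · exact ha.1
    · exact (hxA a ha).1
  have out : ∀ a b, ArcRel (reorient A (entering A U ∪ x)) a b → a ∉ U → b ∉ U ∧ ArcRel A a b := by
    rintro a b (⟨h1, h2⟩ | ⟨⟨c, d⟩, h1, h2⟩) ha
    · refine ⟨fun hb => h2 (Or.inl ⟨h1, ha, hb⟩), h1⟩
    · simp only [Prod.swap, Prod.mk.injEq] at h2
      obtain ⟨rfl, rfl⟩ := h2
      rcases h1 with h1 | h1
      · exact absurd h1.2.2 ha
      · exact absurd (hxA _ h1).2.2 ha
  have inn : ∀ a b, ArcRel (reorient A (entering A U ∪ x)) a b → b ∈ U →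
      a ∈ U ∧ ArcRel (reorient (inducedArcs A U) x) a b := by
    intro a b hab hb
    have ha : a ∈ U := by
      by_contra ha
      exact (out a b hab ha).1 hb
    refine ⟨ha, ?_⟩
    rcases hab with ⟨h1, h2⟩ | ⟨⟨c, d⟩, h1, h2⟩
    · exact Or.inl ⟨⟨h1, ha, hb⟩, fun h3 => h2 (Or.inr h3)⟩
    · simp only [Prod.swap, Prod.mk.injEq] at h2
      obtain ⟨rfl, rfl⟩ := h2
      rcases h1 with h1 | h1
      · exact absurd hb h1.2.1
      · exact Or.inr ⟨(c, d), h1, rfl⟩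
  by_cases hvU : v ∈ U
  · have : ∀ a, TransGen (ArcRel (reorient A (entering A U ∪ x))) a v → a ∈ U ∧
        TransGen (ArcRel (reorient (inducedArcs A U) x)) a v := by
      intro a ha
      induction ha using TransGen.head_induction_on with
      | single h1 => exact ⟨(inn _ _ h1 hvU).1, .single (inn _ _ h1 hvU).2⟩
      | head h1 _ ih => exact ⟨(inn _ _ h1 ih.1).1, .head (inn _ _ h1 ih.1).2 ih.2⟩
    exact hx.2 v (this v hv).2
  · have : ∀ a, TransGen (ArcRel (reorient A (entering A U ∪ x))) v a → a ∉ U ∧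
        TransGen (ArcRel A) v a := by
      intro a ha
      induction ha with
      | single h1 => exact ⟨(out _ _ h1 hvU).1, .single (out _ _ h1 hvU).2⟩
      | tail _ h1 ih => exact ⟨(out _ _ h1 ih.1).1, .tail ih.2 (out _ _ h1 ih.1).2⟩
    exact h v (this v hv).2

theorem exists_lub_of_finite {P : Type*} [PartialOrder P] (bot : P) (hbot : ∀ x, bot ≤ x)
    (h : ∀ x y : P, ∃ z, IsLUB {x, y} z) {S : Set P} (hS : S.Finite) : ∃ z, IsLUB S z := by
  induction S, hS using Set.Finite.induction_on with
  | empty => exact ⟨bot, by simp [IsLUB, IsLeast, upperBounds, lowerBounds, hbot]⟩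
  | insert _ _ ih =>
    rename_i a S _ _
    obtain ⟨z, hz⟩ := ih
    obtain ⟨w, hw⟩ := h a z
    refine ⟨w, ?_, ?_⟩
    · rintro b (rfl | hb)
      · exact hw.1 (by simp)
      · exact (hz.1 hb).trans (hw.1 (by simp))
    · intro b hb
      apply hw.2
      rintro c (rfl | rfl)
      · exact hb (by simp)
      · exact hz.2 fun d hd => hb (Or.inr hd)

theorem ind_acyc {V : Type*} {A : Set (V × V)} (h : AcyclicArcs A) (U : Set V) :
    AcyclicArcs (inducedArcs A U) := fun v hv => h v (tg_mono (fun _ _ h => h.1) hv)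

theorem forward {V : Type*} [Finite V] (A : Set (V × V)) (hA : AcyclicArcs A)
    (h : ∀ x y : ARP A, ∃ z : ARP A, IsLUB {x, y} z) : Vertebrate A := by
  intro U
  set T := transRed (inducedArcs A U) with hT
  intro v c hc
  have hE := ind_acyc hA U
  let F : Set (V × V) := {a ∈ T | ∃ d ∈ c.darts, d.toProd = a.swap}
  let G : Set (V × V) := {a ∈ T | ∃ d ∈ c.darts, d.toProd = a}
  have hFG : ∀ a ∈ F, a ∉ G := by
    rintro a ⟨h1, d, hd, hda⟩ ⟨_, d', hd', hda'⟩
    have hnd : (c.darts.map SimpleGraph.Dart.edge).Nodup := hc.edges_nodup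
    have hdd : d = d' := by
      apply List.inj_on_of_nodup_map hnd hd hd'
      simp only [SimpleGraph.Dart.edge, hda, hda']
      exact Sym2.mk_prod_swap_eq
    subst hdd
    rw [hda] at hda'
    obtain ⟨a1, a2⟩ := a
    simp only [Prod.swap, Prod.mk.injEq] at hda'
    obtain ⟨rfl, _⟩ := hda'
    exact hE _ (.single h1.1)
  let S : Set (ARP A) := {x | ∃ f ∈ F, x.1 = entering A U ∪ {f}}
  obtain ⟨J, hJ⟩ := exists_lub_of_finite (P := ARP A) ⟨∅, ar_empty hA⟩
    (fun x => Set.empty_subset x.1) h (Set.toFinite S)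
  have hF : ∀ f ∈ F, f ∈ J.1 := by
    intro f hf
    have : (⟨entering A U ∪ {f}, ar_lift hA (ar_single hE hf.1)⟩ : ARP A) ≤ J :=
      hJ.1 ⟨f, hf, rfl⟩
    exact this (Or.inr rfl)
  have hG : ∀ g ∈ G, g ∉ J.1 := by
    intro g hg hgJ
    have : J ≤ (⟨entering A U ∪ (inducedArcs A U \ {g}),
        ar_lift hA (ar_compl (ar_single hE hg.1))⟩ : ARP A) := by
      apply hJ.2
      rintro ⟨x, hx'⟩ ⟨f, hf, hx⟩
      change x ⊆ _
      simp only at hx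
      rw [hx]
      apply Set.union_subset_union_right
      rintro _ rfl
      refine ⟨hf.1.1, ?_⟩
      rintro rfl
      exact hFG _ hf hg
    rcases this hgJ with h1 | h1
    · exact h1.2.1 hg.1.1.2.1
    · exact h1.2 rfl
  have hd : ∀ d ∈ c.darts, ArcRel (reorient A J.1) d.fst d.snd := by
    intro d hd
    have hadj : (undirectedGraph T).Adj d.fst d.snd := d.adj
    unfold undirectedGraph at hadj
    rw [SimpleGraph.fromRel_adj] at hadj
    rcases hadj.2 with h1 | h1
    · left
      exact ⟨h1.1.1, hG _ ⟨h1, d, hd, rfl⟩⟩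
    · right
      exact ⟨_, hF _ ⟨h1, d, hd, rfl⟩, rfl⟩
  have key : ∀ (a b : V) (w : (undirectedGraph T).Walk a b),
      (∀ d ∈ w.darts, ArcRel (reorient A J.1) d.fst d.snd) → 
      ReflTransGen (ArcRel (reorient A J.1)) a b := by
    intro a b w
    induction w with
    | nil => intro _; exact .refl
    | cons hadj w ih =>
      intro h
      simp only [SimpleGraph.Walk.darts_cons, List.mem_cons, forall_eq_or_imp] at h
      exact .head h.1 (ih h.2)
  cases c with
  | nil => simp at hc
  | cons hadj w =>
    simp only [SimpleGraph.Walk.darts_cons, List.mem_cons, forall_eq_or_imp] at hd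
    exact J.2.2 v (.head' hd.1 (key _ _ w hd.2))

theorem tr_reach {V : Type*} [Finite V] {E : Set (V × V)} (hE : AcyclicArcs E) :
    ∀ (n : ℕ) (x y : V), {z | TransGen (ArcRel E) x z ∧ TransGen (ArcRel E) z y}.ncard = n →
      TransGen (ArcRel E) x y → TransGen (ArcRel (transRed E)) x y := by
  intro n
  induction n using Nat.strong_induction_on with
  | _ n ih =>
    intro x y hn hxy
    by_cases hz : ∃ z, TransGen (ArcRel E) x z ∧ TransGen (ArcRel E) z y
    · obtain ⟨z, h1, h2⟩ := hz
      refine TransGen.trans (ih _ ?_ x z rfl h1) (ih _ ?_ z y rfl h2)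
      · rw [← hn]
        apply Set.ncard_lt_ncard _ (Set.toFinite _)
        refine ⟨fun w hw => ⟨hw.1, hw.2.trans h2⟩, fun h => ?_⟩
        exact hE z (h ⟨h1, h2⟩ : _ ∧ _).2
      · rw [← hn]
        apply Set.ncard_lt_ncard _ (Set.toFinite _)
        refine ⟨fun w hw => ⟨h1.trans hw.1, hw.2⟩, fun h => ?_⟩
        exact hE z (h ⟨h1, h2⟩ : _ ∧ _).1
    · rcases TransGen.head'_iff.1 hxy with ⟨w, h1, h2⟩
      rcases reflTransGen_iff_eq_or_transGen.1 h2 with rfl | h3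
      · refine .single ⟨h1, ?_⟩
        rintro ⟨w, h4, h5⟩
        exact hz ⟨w, .single h4, h5⟩
      · exact absurd ⟨w, .single h1, h3⟩ hz

theorem no_double {V : Type*} [Finite V] {E : Set (V × V)} (hE : AcyclicArcs E)
    (hf : IsForestArcs (transRed E)) {u a b v : V} (hab : a ≠ b)
    (h1 : (u, a) ∈ transRed E) (h2 : (u, b) ∈ transRed E)
    (ha : ReflTransGen (ArcRel E) a v) (hb : ReflTransGen (ArcRel E) b v) : False := by
  have hne : ∀ x y, (x, y) ∈ transRed E → x ≠ y := by
    rintro x y h rfl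
    exact hE x (.single h.1)
  have adj : ∀ x y, (x, y) ∈ transRed E → (undirectedGraph (transRed E)).Adj x y := by
    intro x y h
    rw [undirectedGraph, SimpleGraph.fromRel_adj]
    exact ⟨hne x y h, Or.inl h⟩
  rw [IsForestArcs, SimpleGraph.isAcyclic_iff_forall_adj_isBridge] at hf
  have hbr := hf (adj _ _ h1)
  rw [SimpleGraph.isBridge_iff] at hbr
  apply hbr
  have reach : ∀ x, (u, x) ∈ E → ReflTransGen (ArcRel E) x v →
      ((undirectedGraph (transRed E)).deleteEdges {s(u, a)}).Reachable x v := by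
    intro x hx hxv
    have hxv' : ReflTransGen (ArcRel (transRed E)) x v := by
      rcases reflTransGen_iff_eq_or_transGen.1 hxv with rfl | h
      · exact .refl
      · exact (tr_reach hE _ x v rfl h).to_reflTransGen
    clear ha hb hxv
    induction hxv' with
    | refl => exact SimpleGraph.Reachable.refl _
    | tail hxy hyz ih =>
      rename_i y z
      have hxy' : ReflTransGen (ArcRel E) x y := ReflTransGen.mono (fun _ _ h => h.1) _ _ hxy
      have huy : TransGen (ArcRel E) u y := TransGen.head' hx hxy'
      refine ih.trans (SimpleGraph.Adj.reachable ?_)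
      rw [SimpleGraph.deleteEdges_adj]
      refine ⟨adj _ _ hyz, ?_⟩
      rw [Set.mem_singleton_iff, Sym2.eq_iff]
      rintro (⟨rfl, _⟩ | ⟨_, rfl⟩)
      · exact hE _ huy
      · exact hE _ (huy.tail hyz.1)
  have hub : ((undirectedGraph (transRed E)).deleteEdges {s(u, a)}).Adj u b := by
    rw [SimpleGraph.deleteEdges_adj]
    refine ⟨adj _ _ h2, ?_⟩
    rw [Set.mem_singleton_iff, Sym2.eq_iff]
    rintro (⟨_, rfl⟩ | ⟨rfl, _⟩)
    · exact hab rfl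
    · exact hE _ (.single h1.1)
  exact hub.reachable.trans ((reach b h2.1 hb).trans (reach a h1.1 ha).symm)

theorem rtg_of_path {V : Type*} {r : V → V → Prop} {n : ℕ} {p : ℕ → V}
    (h : ∀ i < n, r (p i) (p (i+1))) {i j : ℕ} (hij : i ≤ j) (hj : j ≤ n) :
    ReflTransGen r (p i) (p j) := by
  rcases hij.eq_or_lt with rfl | h1
  · exact .refl
  · exact (tg_of_path h h1 hj).to_reflTransGen

theorem cross_aux {V : Type*} {A : Set (V × V)} (hA : AcyclicArcs A) {U : Set V}
    {n l : ℕ} {p q : ℕ → V} (hl : 1 ≤ l)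
    (hp : ∀ i < n, ArcRel A (p i) (p (i+1))) (hq : ∀ i < l, ArcRel A (q i) (q (i+1)))
    (h0 : p 0 = q 0) (h1 : p n = q l)
    (hU : ∀ x ∈ U, (∃ i ≤ n, p i = x) ∨ ∃ i ≤ l, q i = x)
    (hE : (q 0, q 1) ∈ inducedArcs A U)
    (h : (q 0, q 1) ∉ transRed (inducedArcs A U)) :
    ∃ m, 1 ≤ m ∧ m < n ∧ (p m, q 1) ∈ A := by
  have : ∃ w, ArcRel (inducedArcs A U) (q 0) w ∧ TransGen (ArcRel (inducedArcs A U)) w (q 1) := by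
    by_contra h2
    exact h ⟨hE, h2⟩
  obtain ⟨w, hw1, hw2⟩ := this
  obtain ⟨x, hx1, hx2⟩ := TransGen.tail'_iff.1 hw2
  have hux : TransGen (ArcRel A) (q 0) x :=
    .head' hw1.1 (ReflTransGen.mono (fun _ _ h => h.1) _ _ hx1)
  rcases hU x hx2.2.1 with ⟨i, hi, rfl⟩ | ⟨i, hi, rfl⟩
  · refine ⟨i, ?_, ?_, hx2.1⟩
    · by_contra h3
      have : i = 0 := by omega
      subst this
      rw [h0] at hux
      exact hA _ hux
    · by_contra h3
      have : i = n := by omega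
      subst this
      have h4 := rtg_of_path hq hl le_rfl
      have h5 : ArcRel A (p i) (q 1) := hx2.1
      rw [h1] at h5
      exact hA _ (TransGen.head' h5 h4)
  · exfalso
    rcases Nat.eq_zero_or_pos i with rfl | hi0
    · exact hA _ hux
    · exact hA _ (TransGen.tail' (rtg_of_path hq hi0 hi) hx2.1)

theorem cross {V : Type*} [Finite V] {A : Set (V × V)} (hA : AcyclicArcs A) (hV : Vertebrate A)
    {n l : ℕ} {p q : ℕ → V} (hn : 1 ≤ n) (hl : 1 ≤ l)
    (hp : ∀ i < n, ArcRel A (p i) (p (i+1))) (hq : ∀ i < l, ArcRel A (q i) (q (i+1)))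
    (h0 : p 0 = q 0) (h1 : p n = q l) (hne : p 1 ≠ q 1) :
    (∃ m, 1 ≤ m ∧ m < n ∧ (p m, q 1) ∈ A) ∨ (∃ m, 1 ≤ m ∧ m < l ∧ (q m, p 1) ∈ A) := by
  let U : Set V := {x | (∃ i ≤ n, p i = x) ∨ ∃ i ≤ l, q i = x}
  have hpU : ∀ i < n, ArcRel (inducedArcs A U) (p i) (p (i+1)) := fun i hi =>
    ⟨hp i hi, Or.inl ⟨i, by omega, rfl⟩, Or.inl ⟨i+1, by omega, rfl⟩⟩
  have hqU : ∀ i < l, ArcRel (inducedArcs A U) (q i) (q (i+1)) := fun i hi =>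
    ⟨hq i hi, Or.inr ⟨i, by omega, rfl⟩, Or.inr ⟨i+1, by omega, rfl⟩⟩
  by_cases h2 : (q 0, q 1) ∈ transRed (inducedArcs A U)
  · by_cases h3 : (p 0, p 1) ∈ transRed (inducedArcs A U)
    · exfalso
      rw [h0] at h3
      have h4 := rtg_of_path hpU hn le_rfl
      rw [h1] at h4
      exact no_double (ind_acyc hA U) (hV U) hne h3 h2 h4 (rtg_of_path hqU hl le_rfl)
    · right
      exact cross_aux hA hn hq hp h0.symm h1.symm (fun x hx => hx.symm) (hpU 0 hn) h3
  · left
    exact cross_aux hA hl hp hq h0 h1 (fun x hx => hx) (hqU 0 hl) h2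

/-- an arc of an acyclic reorientation cannot be parallel to an unreversed path -/
theorem ar_coclosed {V : Type*} {A B : Set (V × V)} (hB : ARmem A B) {x y : V} (hxy : (x, y) ∈ B)
    (h : TransGen (ArcRel (A \ B)) x y) : False := by
  refine hB.2 x (TransGen.tail (tg_mono (fun _ _ h => Or.inl h) h) ?_)
  exact Or.inr ⟨_, hxy, rfl⟩

theorem ar_closed {V : Type*} {A B : Set (V × V)} (hB : ARmem A B) {x y : V} (hxy : (x, y) ∈ A)
    (h : TransGen (ArcRel B) x y) : (x, y) ∈ B := by
  by_contra h1
  refine ar_coclosed (ar_compl hB) (x := x) (y := y) ⟨hxy, h1⟩ (tg_mono ?_ h)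
  intro a b hab
  exact ⟨hB.1 hab, fun h => h.2 hab⟩

def joinSet {V : Type*} (A B : Set (V × V)) : Set (V × V) :=
  {a ∈ A | TransGen (ArcRel B) a.1 a.2}

theorem key_paths {V : Type*} [Finite V] {A B₁ B₂ : Set (V × V)} (hA : AcyclicArcs A)
    (hV : Vertebrate A) (hB₁ : ARmem A B₁) (hB₂ : ARmem A B₂) :
    ∀ (n l : ℕ) (p q : ℕ → V), 1 ≤ n → 1 ≤ l →
    (∀ i < n, ArcRel (A \ joinSet A (B₁ ∪ B₂)) (p i) (p (i+1))) →
    (∀ i < l, ArcRel (B₁ ∪ B₂) (q i) (q (i+1))) → p 0 = q 0 → p n = q l → False := by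
  have hBA : ∀ x y, ArcRel (B₁ ∪ B₂) x y → ArcRel A x y := by
    rintro x y (h | h)
    · exact hB₁.1 h
    · exact hB₂.1 h
  have hBC : ∀ x y, ArcRel (B₁ ∪ B₂) x y → (x, y) ∈ joinSet A (B₁ ∪ B₂) :=
    fun x y h => ⟨hBA x y h, .single h⟩
  have hco : ∀ x y, ArcRel (B₁ ∪ B₂) x y →
      ¬ TransGen (ArcRel (A \ joinSet A (B₁ ∪ B₂))) x y := by
    rintro x y (h | h) ht
    · exact ar_coclosed hB₁ h (tg_mono (fun a b hab => ⟨hab.1, fun h => hab.2 (hBC _ _ (Or.inl h))⟩) ht)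
    · exact ar_coclosed hB₂ h (tg_mono (fun a b hab => ⟨hab.1, fun h => hab.2 (hBC _ _ (Or.inr h))⟩) ht)
  intro n
  induction n using Nat.strong_induction_on with
  | _ n ihn =>
  intro l
  induction l using Nat.strong_induction_on with
  | _ l ihl =>
  intro p q hn hl hp hq h0 h1
  have hp0 := hp 0 hn
  have hq0 := hq 0 hl
  rw [Nat.zero_add] at hp0 hq0
  by_cases hne : p 1 = q 1
  · apply hp0.2
    rw [h0, hne]
    exact hBC _ _ hq0
  rcases cross hA hV hn hl (fun i hi => (hp i hi).1) (fun i hi => hBA _ _ (hq i hi)) h0 h1 hne with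
    ⟨m, hm1, hmn, hm⟩ | ⟨m, hm1, hml, hm⟩
  · by_cases hC : (p m, q 1) ∈ joinSet A (B₁ ∪ B₂)
    · have ht : TransGen (ArcRel (B₁ ∪ B₂)) (p m) (q l) :=
        TransGen.trans_left hC.2 (rtg_of_path hq hl le_rfl)
      obtain ⟨l', q', hl', hq0', hq1', hq'⟩ := path_of_tg ht
      refine ihn (n - m) (by omega) l' (fun i => p (i + m)) q' (by omega) hl' ?_ hq' ?_ ?_
      · intro i hi
        have := hp (i + m) (by omega)
        rwa [show i + m + 1 = i + 1 + m by omega] at this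
      · simpa using hq0'.symm
      · rw [Nat.sub_add_cancel hmn.le, h1, hq1']
    · refine hco (q 0) (q 1) hq0 ?_
      rw [← h0]
      exact (tg_of_path hp hm1 hmn.le).tail ⟨hm, hC⟩
  · by_cases hC : (q m, p 1) ∈ joinSet A (B₁ ∪ B₂)
    · apply hp0.2
      refine ⟨hp0.1, ?_⟩
      simp only
      rw [h0]
      exact (tg_of_path hq hm1 hml.le).trans hC.2
    · refine ihl (l - m) (by omega) (Function.update p 0 (q m)) (fun i => q (i + m)) hn (by omega)
        ?_ ?_ ?_ ?_
      · intro i hi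
        rw [Function.update_of_ne (show i + 1 ≠ 0 by omega)]
        rcases Nat.eq_zero_or_pos i with rfl | hi0
        · rw [Function.update_self]
          exact ⟨hm, hC⟩
        · rw [Function.update_of_ne (show i ≠ 0 by omega)]
          exact hp i hi
      · intro i hi
        have := hq (i + m) (by omega)
        rwa [show i + m + 1 = i + 1 + m by omega] at this
      · simp
      · rw [Function.update_of_ne (by omega)]
        rw [Nat.sub_add_cancel hml.le, h1]

/-- A minimal set on which a relation with a cycle has no sinks. -/
theorem exists_min_cycle {V : Type*} [Finite V] {R : V → V → Prop} {v : V} (hv : TransGen R v v) :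
    ∃ U : Set V, U.Nonempty ∧ (∀ x ∈ U, ∃ y ∈ U, R x y) ∧
      ∀ W ⊆ U, W.Nonempty → (∀ x ∈ W, ∃ y ∈ W, R x y) → W = U := by
  let S : Set (Set V) := {U | U.Nonempty ∧ (∀ x ∈ U, ∃ y ∈ U, R x y)}
  have hS : S.Nonempty := by
    refine ⟨{x | TransGen R v x ∧ TransGen R x v}, ⟨v, hv, hv⟩, ?_⟩
    rintro x ⟨h1, h2⟩
    obtain ⟨y, h3, h4⟩ := TransGen.head'_iff.1 h2
    refine ⟨y, ⟨h1.tail h3, ?_⟩, h3⟩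
    exact TransGen.trans_right h4 hv
  obtain ⟨U, hU, hmin⟩ := Set.exists_min_image S Set.ncard (Set.toFinite S) hS
  refine ⟨U, hU.1, hU.2, fun W hW h1 h2 => ?_⟩
  exact Set.eq_of_subset_of_ncard_le hW (hmin W ⟨h1, h2⟩) (Set.toFinite _)

theorem min_in_unique {V : Type*} [Finite V] {R : V → V → Prop} {U : Set V}
    (hU : ∀ x ∈ U, ∃ y ∈ U, R x y)
    (hmin : ∀ W ⊆ U, W.Nonempty → (∀ x ∈ W, ∃ y ∈ W, R x y) → W = U)
    {f : V → V} (hf : ∀ x ∈ U, f x ∈ U ∧ R x (f x)) : Set.InjOn f U ∧ f '' U = U := by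
  have himg : f '' U = U := by
    rcases U.eq_empty_or_nonempty with rfl | hne
    · simp
    apply hmin
    · rintro _ ⟨x, hx, rfl⟩
      exact (hf x hx).1
    · exact hne.image f
    · rintro _ ⟨x, hx, rfl⟩
      exact ⟨f (f x), ⟨f x, (hf x hx).1, rfl⟩, (hf _ (hf x hx).1).2⟩
  refine ⟨?_, himg⟩
  apply Set.injOn_of_ncard_image_eq
  · rw [himg]
  · exact Set.toFinite _

theorem ar_join {V : Type*} [Finite V] {A B₁ B₂ : Set (V × V)} (hA : AcyclicArcs A)
    (hV : Vertebrate A) (hB₁ : ARmem A B₁) (hB₂ : ARmem A B₂) :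
    ARmem A (joinSet A (B₁ ∪ B₂)) := by
  classical
  refine ⟨fun a ha => ha.1, fun v hv => ?_⟩
  set C := joinSet A (B₁ ∪ B₂) with hC
  have hCA : C ⊆ A := fun a ha => ha.1
  set R := ArcRel (reorient A C) with hR
  have hcl : ∀ x y, (x, y) ∈ A → TransGen (ArcRel C) x y → (x, y) ∈ C := by
    intro x y hxy h
    refine ⟨hxy, ?_⟩
    have : TransGen (TransGen (ArcRel (B₁ ∪ B₂))) x y := tg_mono (fun a b h => h.2) h
    rwa [transGen_idem] at this
  have hco : ∀ x y, (x, y) ∈ C → ¬ TransGen (ArcRel (A \ C)) x y := by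
    intro x y hxy h
    obtain ⟨n, p, hn, hp0, hp1, hp⟩ := path_of_tg h
    obtain ⟨l, q, hl, hq0, hq1, hq⟩ := path_of_tg hxy.2
    exact key_paths hA hV hB₁ hB₂ n l p q hn hl hp hq (hp0.trans hq0.symm) (hp1.trans hq1.symm)
  have hRiff : ∀ x y, R x y ↔ ((x, y) ∈ A ∧ (x, y) ∉ C) ∨ (y, x) ∈ C := by
    intro x y
    constructor
    · rintro (h | ⟨⟨a, b⟩, h, h'⟩)
      · exact Or.inl h
      · simp only [Prod.swap, Prod.mk.injEq] at h'
        obtain ⟨rfl, rfl⟩ := h'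
        exact Or.inr h
    · rintro (h | h)
      · exact Or.inl h
      · exact Or.inr ⟨_, h, rfl⟩
  have hasym : ∀ x y, (x, y) ∈ A → (y, x) ∉ A := fun x y h1 h2 =>
    hA x (.head h1 (.single h2))
  have hRasym : ∀ x y, R x y → ¬ R y x := by
    intro x y h1 h2
    rw [hRiff] at h1 h2
    rcases h1 with h1 | h1 <;> rcases h2 with h2 | h2
    · exact hasym _ _ h1.1 h2.1
    · exact h1.2 h2
    · exact h2.2 h1
    · exact hasym _ _ (hCA h1) (hCA h2)
  obtain ⟨U, hne, hU, hmin⟩ := exists_min_cycle hv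
  have hU' := hU
  choose! f hfU hfR using hU'
  have hf : ∀ x ∈ U, f x ∈ U ∧ R x (f x) := fun x hx => ⟨hfU x hx, hfR x hx⟩
  have hin : ∀ a ∈ U, ∀ a' ∈ U, ∀ b ∈ U, R a b → R a' b → a = a' := by
    intro a ha a' ha' b hb h1 h2
    let g : V → V := fun x => if x = a ∨ x = a' then b else f x
    have hg : ∀ x ∈ U, g x ∈ U ∧ R x (g x) := by
      intro x hx
      by_cases h : x = a ∨ x = a'
      · simp only [g, h, if_true]
        refine ⟨hb, ?_⟩
        rcases h with rfl | rfl <;> assumption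
      · simp only [g, h, if_false]
        exact hf x hx
    exact (min_in_unique hU hmin hg).1 ha ha' (by simp [g])
  have hout : ∀ b ∈ U, ∀ c ∈ U, R b c → c = f b := by
    intro b hb c hc h
    have : c ∈ f '' U := by rw [(min_in_unique hU hmin hf).2]; exact hc
    obtain ⟨a, ha, rfl⟩ := this
    rw [hin a ha b hb (f a) hc (hfR a ha) h]
  have hout' : ∀ b ∈ U, ∀ c ∈ U, ∀ c' ∈ U, R b c → R b c' → c = c' := by
    intro b hb c hc c' hc' h h'
    rw [hout b hb c hc h, hout b hb c' hc' h']
  have hTR : ∀ x ∈ U, ∀ y ∈ U, (x, y) ∈ A → (x, y) ∈ transRed (inducedArcs A U) := by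
    intro x hx y hy hxy
    refine ⟨⟨hxy, hx, hy⟩, ?_⟩
    rintro ⟨w, hw1, hw2⟩
    have hwy : w ≠ y := by
      rintro rfl
      exact ind_acyc hA U _ hw2
    by_cases hxyC : (x, y) ∈ C
    · apply hco x y hxyC
      have hxw : (x, w) ∉ C := fun h =>
        hwy (hin w hw1.2.2 y hy x hx ((hRiff _ _).2 (Or.inr h)) ((hRiff _ _).2 (Or.inr hxyC)))
      have : ∀ z, TransGen (ArcRel (inducedArcs A U)) w z → 
          TransGen (ArcRel (A \ C)) x z ∧ ∃ t ∈ U, (t, z) ∈ A \ C := by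
        have step : ∀ t ∈ U, ∀ z z', (t, z) ∈ A \ C → ArcRel (inducedArcs A U) z z' →
            (z, z') ∈ A \ C := by
          intro t ht z z' h1 h2
          refine ⟨h2.1, fun h3 => ?_⟩
          have := hin t ht z' h2.2.2 z h2.2.1 ((hRiff _ _).2 (Or.inl h1))
            ((hRiff _ _).2 (Or.inr h3))
          subst this
          exact hasym _ _ h1.1 h2.1
        intro z hz
        induction hz with
        | single h =>
          have := step x hx _ _ ⟨hw1.1, hxw⟩ h
          exact ⟨.head ⟨hw1.1, hxw⟩ (.single this), w, hw1.2.2, this⟩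
        | tail _ h ih =>
          obtain ⟨h1, t, ht, h2⟩ := ih
          have := step t ht _ _ h2 h
          exact ⟨h1.tail this, _, h.2.1, this⟩
      exact (this y hw2).1
    · apply hxyC
      apply hcl x y hxy
      have hxw : (x, w) ∈ C := by
        by_contra h
        exact hwy (hout' x hx w hw1.2.2 y hy ((hRiff _ _).2 (Or.inl ⟨hw1.1, h⟩))
          ((hRiff _ _).2 (Or.inl ⟨hxy, hxyC⟩)))
      have : ∀ z, TransGen (ArcRel (inducedArcs A U)) w z → 
          TransGen (ArcRel C) x z ∧ ∃ t ∈ U, (t, z) ∈ C := by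
        have step : ∀ t ∈ U, ∀ z z', (t, z) ∈ C → ArcRel (inducedArcs A U) z z' →
            (z, z') ∈ C := by
          intro t ht z z' h1 h2
          by_contra h3
          have := hout' z h2.2.1 t ht z' h2.2.2 ((hRiff _ _).2 (Or.inr h1))
            ((hRiff _ _).2 (Or.inl ⟨h2.1, h3⟩))
          subst this
          exact hasym _ _ (hCA h1) h2.1
        intro z hz
        induction hz with
        | single h =>
          have := step x hx _ _ hxw h
          exact ⟨.head hxw (.single this), w, hw1.2.2, this⟩
        | tail _ h ih =>
          obtain ⟨h1, t, ht, h2⟩ := ih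
          have := step t ht _ _ h2 h
          exact ⟨h1.tail this, _, h.2.1, this⟩
      exact (this y hw2).1
  have hadj : ∀ x ∈ U, (undirectedGraph (transRed (inducedArcs A U))).Adj x (f x) := by
    intro x hx
    rw [undirectedGraph, SimpleGraph.fromRel_adj]
    refine ⟨fun h => ?_, ?_⟩
    · have := hfR x hx
      rw [← h] at this
      exact hRasym _ _ this this
    · rcases (hRiff _ _).1 (hfR x hx) with h | h
      · exact Or.inl (hTR _ hx _ (hfU x hx) h.1)
      · exact Or.inr (hTR _ (hfU x hx) _ hx (hCA h))
  obtain ⟨b, hb⟩ := hne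
  have hbr := SimpleGraph.isAcyclic_iff_forall_adj_isBridge.1 (hV U) (hadj b hb)
  rw [SimpleGraph.isBridge_iff] at hbr
  apply hbr
  set G' := (undirectedGraph (transRed (inducedArcs A U))).deleteEdges {s(b, f b)} with hG'
  by_contra hcon
  let W : Set V := {x ∈ U | ¬ G'.Reachable x b}
  have hW : W = U := by
    apply hmin W (fun x hx => hx.1)
    · exact ⟨f b, hfU b hb, fun h => hcon h.symm⟩
    · rintro x ⟨hx, hxr⟩
      refine ⟨f x, ⟨hfU x hx, fun h => hxr ?_⟩, hfR x hx⟩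
      refine SimpleGraph.Reachable.trans (SimpleGraph.Adj.reachable ?_) h
      rw [hG', SimpleGraph.deleteEdges_adj]
      refine ⟨hadj x hx, ?_⟩
      rw [Set.mem_singleton_iff, Sym2.eq_iff]
      rintro (⟨rfl, _⟩ | ⟨h1, h2⟩)
      · exact hxr (SimpleGraph.Reachable.refl _)
      · have h3 := hfR x hx
        rw [h2, h1] at h3
        exact hRasym _ _ h3 (hfR b hb)
  have : b ∈ W := by rw [hW]; exact hb
  exact this.2 (SimpleGraph.Reachable.refl _)

theorem join_exists {V : Type*} [Finite V] {A : Set (V × V)} (hA : AcyclicArcs A)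
    (hV : Vertebrate A) (x y : ARP A) : ∃ z : ARP A, IsLUB {x, y} z := by
  refine ⟨⟨joinSet A (x.1 ∪ y.1), ar_join hA hV x.2 y.2⟩, ?_, ?_⟩
  · rintro z (rfl | rfl)
    · exact fun a ha => ⟨z.2.1 ha, .single (Or.inl ha)⟩
    · exact fun a ha => ⟨z.2.1 ha, .single (Or.inr ha)⟩
  · intro z hz a ha
    have hx : x ≤ z := hz (by simp)
    have hy : y ≤ z := hz (by simp)
    refine ar_closed z.2 ha.1 (tg_mono ?_ ha.2)
    rintro c d (h | h)
    · exact hx h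
    · exact hy h

def complAR {V : Type*} {A : Set (V × V)} (x : ARP A) : ARP A := ⟨A \ x.1, ar_compl x.2⟩

theorem complAR_complAR {V : Type*} {A : Set (V × V)} (x : ARP A) : complAR (complAR x) = x :=
  Subtype.ext (Set.diff_diff_cancel_left x.2.1)

theorem complAR_anti {V : Type*} {A : Set (V × V)} {x y : ARP A} (h : x ≤ y) :
    complAR y ≤ complAR x := fun _ ha => ⟨ha.1, fun hx => ha.2 (h hx)⟩

theorem meet_exists {V : Type*} [Finite V] {A : Set (V × V)} (hA : AcyclicArcs A)
    (hV : Vertebrate A) (x y : ARP A) : ∃ z : ARP A, IsGLB {x, y} z := by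
  obtain ⟨z, hz⟩ := join_exists hA hV (complAR x) (complAR y)
  refine ⟨complAR z, ?_, ?_⟩
  · rintro w (rfl | rfl)
    · rw [← complAR_complAR w]
      exact complAR_anti (hz.1 (by simp))
    · rw [← complAR_complAR w]
      exact complAR_anti (hz.1 (by simp))
  · intro w hw
    rw [← complAR_complAR w]
    apply complAR_anti
    apply hz.2
    rintro c (rfl | rfl)
    · exact complAR_anti (hw (by simp))
    · exact complAR_anti (hw (by simp))

/-- The acyclic reorientation poset of a directed acyclic graph `D`
is a lattice if and only if `D` is vertebrate. -/
theorem stmt_0 {V : Type*} [Fintype V] (A : Set (V × V)) (hA : IsDAG A) :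
    ((∀ x y : ARP A, ∃ z : ARP A, IsLUB {x, y} z) ∧
      (∀ x y : ARP A, ∃ z : ARP A, IsGLB {x, y} z)) ↔ Vertebrate A :=
  ⟨fun h => forward A hA.2.2 h.1,
    fun h => ⟨join_exists hA.2.2 h, meet_exists hA.2.2 h⟩⟩
end

section
/- Let D = (V, A) and D' = (V, A') be vertebrate directed acyclic graphs with A ⊇ A', so that AR(D) and AR(D') are lattices. The restriction map ρ : AR(D) → AR(D') is a lattice homomorphism (ρ(B ∨ C) = ρ(B) ∨ ρ(C) and ρ(B ∧ C) = ρ(B) ∧ ρ(C) for all B, C ∈ AR(D); equivalently a lattice quotient map, since ρ is surjective) if and only if D' is pathful in D, i.e., every directed path in D from u to v with (u,v) ∈ A' has all of its arcs in A'. -/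
/-- `A'` is pathful in `A`: every directed path in `A` joining the endpoints of an
arc of `A'` is contained in `A'`. -/
def Pathful {V : Type*} (A A' : Set (V × V)) : Prop :=
  ∀ p : List V, p.Chain' (fun x y => (x, y) ∈ A) →
    ∀ u v : V, p.head? = some u → p.getLast? = some v → (u, v) ∈ A' →
      ∀ a ∈ p.zip p.tail, a ∈ A'

/-- `z` is the join (least upper bound) of `x` and `y` in `AR(A)`. -/
def IsJoinAR {V : Type*} (A x y z : Set (V × V)) : Prop :=
  ARmem A z ∧ x ⊆ z ∧ y ⊆ z ∧ ∀ w, ARmem A w → x ⊆ w → y ⊆ w → z ⊆ w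

/-- `z` is the meet (greatest lower bound) of `x` and `y` in `AR(A)`. -/
def IsMeetAR {V : Type*} (A x y z : Set (V × V)) : Prop :=
  ARmem A z ∧ z ⊆ x ∧ z ⊆ y ∧ ∀ w, ARmem A w → w ⊆ x → w ⊆ y → w ⊆ z

open Relation

namespace Stmt8

variable {V : Type*}

def Closed (A B : Set (V × V)) : Prop :=
  ∀ u v, (u, v) ∈ A → TransGen (ArcRel B) u v → (u, v) ∈ B

theorem mem_reorient {A B : Set (V × V)} {x y : V} :
    (x, y) ∈ reorient A B ↔ ((x, y) ∈ A ∧ (x, y) ∉ B) ∨ (y, x) ∈ B := by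
  unfold reorient
  constructor
  · rintro (h | ⟨⟨a, b⟩, h, h'⟩)
    · exact Or.inl h
    · simp only [Prod.swap_prod_mk, Prod.mk.injEq] at h'
      obtain ⟨rfl, rfl⟩ := h'
      exact Or.inr h
  · rintro (h | h)
    · exact Or.inl h
    · exact Or.inr ⟨(y, x), h, rfl⟩

theorem mem_reorient_compl {A B : Set (V × V)} (hB : B ⊆ A) {x y : V} :
    (x, y) ∈ reorient A (A \ B) ↔ (y, x) ∈ reorient A B := by
  rw [mem_reorient, mem_reorient]
  have := @hB (x, y)
  simp only [Set.mem_diff]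
  tauto

theorem tgm {R S : V → V → Prop} (h : ∀ a b, R a b → S a b) {x y : V} (hxy : TransGen R x y) :
    TransGen S x y := by
  induction hxy with
  | single h' => exact .single (h _ _ h')
  | tail _ h' ih => exact ih.tail (h _ _ h')

theorem rtgm {R S : V → V → Prop} (h : ∀ a b, R a b → S a b) {x y : V}
    (hxy : ReflTransGen R x y) : ReflTransGen S x y := by
  induction hxy with
  | refl => exact .refl
  | tail _ h' ih => exact ih.tail (h _ _ h')

theorem tg_mono {E F : Set (V × V)} (h : E ⊆ F) {x y : V} (hxy : TransGen (ArcRel E) x y) :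
    TransGen (ArcRel F) x y := tgm (fun _ _ hab => h hab) hxy

theorem rtg_mono {E F : Set (V × V)} (h : E ⊆ F) {x y : V}
    (hxy : ReflTransGen (ArcRel E) x y) :
    ReflTransGen (ArcRel F) x y := rtgm (fun _ _ hab => h hab) hxy

theorem acyclic_mono {E F : Set (V × V)} (h : E ⊆ F) (hF : AcyclicArcs F) : AcyclicArcs E :=
  fun v hv => hF v (tg_mono h hv)

theorem armem_compl {A B : Set (V × V)} (h : ARmem A B) : ARmem A (A \ B) := by
  refine ⟨Set.diff_subset, fun v hv => h.2 v ?_⟩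
  have : TransGen (Function.swap (ArcRel (reorient A B))) v v :=
    tgm (fun a b hab => (mem_reorient_compl h.1).1 hab) hv
  exact transGen_swap.1 this

theorem armem_closed {A B : Set (V × V)} (h : ARmem A B) : Closed A B := by
  intro u v huv hp
  by_contra hB
  have h1 : TransGen (Function.swap (ArcRel (reorient A B))) u v :=
    tgm (fun a b hab => mem_reorient.2 (Or.inr hab)) hp
  have h2 := transGen_swap.1 h1
  exact h.2 v (h2.tail (mem_reorient.2 (Or.inl ⟨huv, hB⟩)))

/-- transitive reduction has the same reachability -/
theorem tg_transRed [Fintype V] {E : Set (V × V)} (hE : AcyclicArcs E) :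
    ∀ (n : ℕ) (x y : V),
      Set.ncard {z | TransGen (ArcRel E) x z ∧ TransGen (ArcRel E) z y} ≤ n →
      TransGen (ArcRel E) x y → TransGen (ArcRel (transRed E)) x y := by
  intro n
  induction n with
  | zero =>
    intro x y hn hxy
    have he : {z | TransGen (ArcRel E) x z ∧ TransGen (ArcRel E) z y} = ∅ := by
      rw [← Set.ncard_eq_zero (Set.toFinite _)]; omega
    have hno : ∀ z, TransGen (ArcRel E) x z → TransGen (ArcRel E) z y → False := by
      intro z h1 h2
      have : z ∈ {z | TransGen (ArcRel E) x z ∧ TransGen (ArcRel E) z y} := ⟨h1, h2⟩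
      rw [he] at this; exact this
    cases hxy with
    | single h =>
      refine TransGen.single ⟨h, ?_⟩
      rintro ⟨w, h1, h2⟩
      exact hno w (.single h1) h2
    | tail h h' => exact (hno _ h (.single h')).elim
  | succ n ih =>
    intro x y hn hxy
    have key : ∀ w, TransGen (ArcRel E) x w → TransGen (ArcRel E) w y →
        TransGen (ArcRel (transRed E)) x y := by
      intro w h1 h2
      refine TransGen.trans (ih x w ?_ h1) (ih w y ?_ h2)
      · refine Nat.le_of_lt_succ (lt_of_lt_of_le (Set.ncard_lt_ncard ?_ (Set.toFinite _)) hn)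
        refine ⟨fun z hz => ⟨hz.1, hz.2.trans h2⟩, fun hs => ?_⟩
        exact hE w (hs (show w ∈ _ from ⟨h1, h2⟩)).2
      · refine Nat.le_of_lt_succ (lt_of_lt_of_le (Set.ncard_lt_ncard ?_ (Set.toFinite _)) hn)
        refine ⟨fun z hz => ⟨h1.trans hz.1, hz.2⟩, fun hs => ?_⟩
        exact hE w (hs (show w ∈ _ from ⟨h1, h2⟩)).1
    cases hxy with
    | single h =>
      by_cases hw : ∃ w, ArcRel E x w ∧ TransGen (ArcRel E) w y
      · obtain ⟨w, h1, h2⟩ := hw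
        exact key w (.single h1) h2
      · exact TransGen.single ⟨h, hw⟩
    | tail h h' => exact key _ h (.single h')

theorem rtg_transRed [Fintype V] {E : Set (V × V)} (hE : AcyclicArcs E) {x y : V}
    (h : ReflTransGen (ArcRel E) x y) : ReflTransGen (ArcRel (transRed E)) x y := by
  rcases reflTransGen_iff_eq_or_transGen.1 h with rfl | h
  · exact .refl
  · exact (tg_transRed hE _ x y le_rfl h).to_reflTransGen

theorem bridge {T : Set (V × V)} (hT : IsForestArcs T) {x y : V} (hne : x ≠ y)
    (h : (x, y) ∈ T ∨ (y, x) ∈ T) :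
    ¬ ((undirectedGraph T) \ SimpleGraph.fromEdgeSet {s(x, y)}).Reachable x y := by
  have h1 := SimpleGraph.isAcyclic_iff_forall_edge_isBridge.1 hT
  have h2 : s(x, y) ∈ (undirectedGraph T).edgeSet := by
    rw [SimpleGraph.mem_edgeSet]
    exact (SimpleGraph.fromRel_adj _ _ _).2 ⟨hne, h⟩
  have h3 := h1 h2
  rw [SimpleGraph.isBridge_iff] at h3
  exact h3

theorem bridge_step {T : Set (V × V)} {x y a b : V} (hab : a ≠ b)
    (h : (a, b) ∈ T ∨ (b, a) ∈ T) (hne : s(a, b) ≠ s(x, y)) :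
    ((undirectedGraph T) \ SimpleGraph.fromEdgeSet {s(x, y)}).Reachable a b := by
  refine SimpleGraph.Adj.reachable ?_
  rw [SimpleGraph.sdiff_adj]
  refine ⟨(SimpleGraph.fromRel_adj _ _ _).2 ⟨hab, h⟩, fun h' => ?_⟩
  rw [SimpleGraph.fromEdgeSet_adj] at h'
  exact hne h'.1

theorem rtg_induced {A P : Set (V × V)} (hP : P ⊆ A) {p v : V} {U : Set V}
    (hU : ∀ z, ReflTransGen (ArcRel P) p z → ReflTransGen (ArcRel P) z v → z ∈ U) :
    ∀ z, ReflTransGen (ArcRel P) z v → ReflTransGen (ArcRel P) p z →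
      ReflTransGen (ArcRel (inducedArcs A U)) z v := by
  intro z hz
  induction hz using ReflTransGen.head_induction_on with
  | refl => intro _; exact .refl
  | head h h' ih =>
    intro hp
    exact .head ⟨hP h, hU _ hp (.head h h'), hU _ (hp.tail h) h'⟩ (ih (hp.tail h))

theorem induced_subset (A : Set (V × V)) (U : Set V) : inducedArcs A U ⊆ A := fun _ h => h.1

/-- one half of the argument that an arc belongs to the transitive reduction -/
theorem arc_in_red {A P Q : Set (V × V)} (hA : IsDAG A) (hP : P ⊆ A) {u p q v : V} {U : Set V}
    (hup : (u, p) ∈ A) (huU : u ∈ U) (hpU : p ∈ U)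
    (hU : ∀ z ∈ U, z = u ∨
      (ReflTransGen (ArcRel P) p z ∧ ReflTransGen (ArcRel P) z v) ∨
      (ReflTransGen (ArcRel Q) q z ∧ ReflTransGen (ArcRel Q) z v))
    (hno : ¬ ∃ x, ReflTransGen (ArcRel Q) q x ∧ ReflTransGen (ArcRel Q) x v ∧ (x, p) ∈ A) :
    (u, p) ∈ transRed (inducedArcs A U) := by
  refine ⟨⟨hup, huU, hpU⟩, ?_⟩
  rintro ⟨w, h1, h2⟩
  obtain ⟨x, h3, h4⟩ := TransGen.tail'_iff.1 h2
  rcases hU x h4.2.1 with rfl | h | h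
  · exact hA.2.2 x (TransGen.head' h1.1 (rtg_mono (induced_subset A U) h3))
  · exact hA.2.2 p (TransGen.tail' (rtg_mono hP h.1) h4.1)
  · exact hno ⟨x, h.1, h.2, h4.1⟩

theorem key [Fintype V] {A P Q : Set (V × V)} (hA : IsDAG A) (hV : Vertebrate A)
    (hP : P ⊆ A) (hQ : Q ⊆ A) {u p q v : V} (hup : (u, p) ∈ P) (huq : (u, q) ∈ Q)
    (hpv : ReflTransGen (ArcRel P) p v) (hqv : ReflTransGen (ArcRel Q) q v) (hpq : p ≠ q) :
    (∃ x, ReflTransGen (ArcRel Q) q x ∧ ReflTransGen (ArcRel Q) x v ∧ (x, p) ∈ A) ∨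
    (∃ x, ReflTransGen (ArcRel P) p x ∧ ReflTransGen (ArcRel P) x v ∧ (x, q) ∈ A) := by
  by_contra hcon
  rw [not_or] at hcon
  obtain ⟨hc1, hc2⟩ := hcon
  set U : Set V := {z | z = u ∨
      (ReflTransGen (ArcRel P) p z ∧ ReflTransGen (ArcRel P) z v) ∨
      (ReflTransGen (ArcRel Q) q z ∧ ReflTransGen (ArcRel Q) z v)} with hUdef
  have hpT : (u, p) ∈ transRed (inducedArcs A U) :=
    arc_in_red hA hP (hP hup) (Or.inl rfl) (Or.inr (Or.inl ⟨.refl, hpv⟩)) (fun z hz => hz) hc1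
  have hqT : (u, q) ∈ transRed (inducedArcs A U) :=
    arc_in_red hA hQ (hQ huq) (Or.inl rfl) (Or.inr (Or.inr ⟨.refl, hqv⟩))
      (fun z hz => by
        rcases hz with h | h | h
        · exact Or.inl h
        · exact Or.inr (Or.inr h)
        · exact Or.inr (Or.inl h)) hc2
  have hEac : AcyclicArcs (inducedArcs A U) := acyclic_mono (induced_subset A U) hA.2.2
  have hTsub : transRed (inducedArcs A U) ⊆ A := fun a ha => ha.1.1
  have hpvT := rtg_transRed hEac (rtg_induced (U := U) hP
    (fun z h1 h2 => Or.inr (Or.inl ⟨h1, h2⟩)) p hpv .refl)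
  have hqvT := rtg_transRed hEac (rtg_induced (U := U) hQ
    (fun z h1 h2 => Or.inr (Or.inr ⟨h1, h2⟩)) q hqv .refl)
  refine bridge (hV U) (hA.1 _ (hP hup)) (Or.inl hpT) ?_
  have walk : ∀ r, (u, r) ∈ A → ∀ z, ReflTransGen (ArcRel (transRed (inducedArcs A U))) r z →
      ((undirectedGraph (transRed (inducedArcs A U))) \
        SimpleGraph.fromEdgeSet {s(u, p)}).Reachable r z := by
    intro r hr z hz
    induction hz with
    | refl => exact SimpleGraph.Reachable.refl _
    | tail h h' ih =>
      refine ih.trans (bridge_step (hA.1 _ (hTsub h')) (Or.inl h') ?_)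
      intro hs
      have hub := TransGen.head' (r := ArcRel A) hr (rtg_mono hTsub h)
      rcases Sym2.eq_iff.1 hs with ⟨rfl, _⟩ | ⟨_, rfl⟩
      · exact hA.2.2 _ hub
      · exact hA.2.2 _ (hub.tail (hTsub h'))
  refine ((bridge_step (hA.1 _ (hQ huq)) (Or.inl hqT) ?_).trans
    (walk q (hQ huq) v hqvT)).trans (walk p (hP hup) v hpvT).symm
  intro hs
  rcases Sym2.eq_iff.1 hs with ⟨_, h⟩ | ⟨h, _⟩
  · exact hpq h.symm
  · exact hA.1 _ (hP hup) h

def clo (A S : Set (V × V)) : Set (V × V) := {a ∈ A | TransGen (ArcRel S) a.1 a.2}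

theorem tg_of_clo {A S : Set (V × V)} {x y : V} (h : TransGen (ArcRel (clo A S)) x y) :
    TransGen (ArcRel S) x y := by
  induction h with
  | single h => exact h.2
  | tail _ h ih => exact ih.trans h.2

theorem clo_closed (A S : Set (V × V)) : Closed A (clo A S) :=
  fun _ _ h h' => ⟨h, tg_of_clo h'⟩

theorem subset_clo {A S : Set (V × V)} (h : S ⊆ A) : S ⊆ clo A S :=
  fun _ ha => ⟨h ha, .single ha⟩

theorem wf_arc [Fintype V] {A : Set (V × V)} (hA : AcyclicArcs A) :
    WellFounded (fun x y => TransGen (ArcRel A) y x) := by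
  have : IsTrans V (fun x y => TransGen (ArcRel A) y x) := ⟨fun a b c h1 h2 => h2.trans h1⟩
  have : Std.Irrefl (fun x y => TransGen (ArcRel A) y x) := ⟨fun a h => hA a h⟩
  exact Finite.wellFounded_of_trans_of_irrefl _

theorem no_both [Fintype V] {A B C : Set (V × V)} (hA : IsDAG A) (hV : Vertebrate A)
    (hB : B ⊆ A) (hC : C ⊆ A) (hB2 : Closed A (A \ B)) (hC2 : Closed A (A \ C)) (v : V) :
    ∀ u, TransGen (ArcRel (B ∪ C)) u v →
      TransGen (ArcRel (A \ clo A (B ∪ C))) u v → False := by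
  intro u
  have hBC : B ∪ C ⊆ A := Set.union_subset hB hC
  have hsub : B ∪ C ⊆ clo A (B ∪ C) := subset_clo hBC
  induction u using (wf_arc hA.2.2).induction with
  | _ u ih =>
  intro hP hQ
  obtain ⟨p, hup, hpv⟩ := TransGen.head'_iff.1 hP
  obtain ⟨q, huq, hqv⟩ := TransGen.head'_iff.1 hQ
  by_cases hpq : p = q
  · subst hpq
    exact huq.2 (hsub hup)
  rcases key hA hV hBC Set.diff_subset hup huq hpv hqv hpq with ⟨x, h1, h2, h3⟩ | ⟨x, h1, h2, h3⟩
  · have hux : TransGen (ArcRel A) u x :=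
      tg_mono Set.diff_subset (TransGen.head' huq h1)
    have hxv : TransGen (ArcRel (A \ clo A (B ∪ C))) x v := by
      rcases reflTransGen_iff_eq_or_transGen.1 h2 with rfl | h
      · exact (hA.2.2 _ (TransGen.head' (r := ArcRel A) h3 (rtg_mono hBC hpv))).elim
      · exact h
    have aux : ∀ D : Set (V × V), D ⊆ B ∪ C → Closed A (A \ D) → (u, p) ∈ D → (x, p) ∈ D := by
      intro D hD hD2 hupD
      by_contra hxp
      have : TransGen (ArcRel (A \ D)) u x :=
        tg_mono (E := A \ clo A (B ∪ C)) (F := A \ D) (fun a ha => ⟨ha.1, fun h => ha.2 (hsub (hD h))⟩) (TransGen.head' huq h1)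
      exact (hD2 u p (hBC hup) (this.tail ⟨h3, hxp⟩)).2 hupD
    have hxp : (x, p) ∈ B ∪ C := by
      rcases hup with h | h
      · exact Or.inl (aux B Set.subset_union_left hB2 h)
      · exact Or.inr (aux C Set.subset_union_right hC2 h)
    exact ih x hux (TransGen.head' hxp hpv) hxv
  · have hux' : TransGen (ArcRel (B ∪ C)) u x := TransGen.head' hup h1
    have hux : TransGen (ArcRel A) u x := tg_mono hBC hux'
    have hxv : TransGen (ArcRel (B ∪ C)) x v := by
      rcases reflTransGen_iff_eq_or_transGen.1 h2 with rfl | h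
      · exact (hA.2.2 _ (TransGen.head' (r := ArcRel A) h3
          (rtg_mono Set.diff_subset hqv))).elim
      · exact h
    have hxq : (x, q) ∈ A \ clo A (B ∪ C) :=
      ⟨h3, fun h => huq.2 ⟨huq.1, hux'.trans h.2⟩⟩
    exact ih x hux hxv (TransGen.head' hxq hqv)

theorem clo_coclosed [Fintype V] {A B C : Set (V × V)} (hA : IsDAG A) (hV : Vertebrate A)
    (hB : B ⊆ A) (hC : C ⊆ A) (hB2 : Closed A (A \ B)) (hC2 : Closed A (A \ C)) :
    Closed A (A \ clo A (B ∪ C)) :=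
  fun u v huv h => ⟨huv, fun h' => no_both hA hV hB hC hB2 hC2 v u h'.2 h⟩

/-- finite paths as functions -/
theorem exists_path {R : V → V → Prop} {u v : V} (h : TransGen R u v) :
    ∃ (n : ℕ) (w : ℕ → V), 0 < n ∧ w 0 = u ∧ w n = v ∧ ∀ i < n, R (w i) (w (i + 1)) := by
  induction h with
  | @single b h =>
    refine ⟨1, fun i => if i = 0 then u else b, one_pos, rfl, rfl, ?_⟩
    intro i hi
    obtain rfl : i = 0 := by omega
    simpa using h
  | @tail b c _ h ih =>
    obtain ⟨n, w, hn, h0, h1, h2⟩ := ih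
    refine ⟨n + 1, fun i => if i ≤ n then w i else c, by omega, by simp [h0], by simp, ?_⟩
    intro i hi
    by_cases hin : i < n
    · have : i + 1 ≤ n := hin
      simpa [hin.le, this] using h2 i hin
    · obtain rfl : i = n := by omega
      simpa [h1] using h

theorem rtg_path {R : V → V → Prop} {w : ℕ → V} {n : ℕ} (h : ∀ i < n, R (w i) (w (i + 1))) :
    ∀ i j, i ≤ j → j ≤ n → ReflTransGen R (w i) (w j) := by
  intro i j hij
  induction j, hij using Nat.le_induction with
  | base => intro _; exact .refl
  | succ j _ ih => intro hj; exact (ih (by omega)).tail (h j hj)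

theorem tg_path {R : V → V → Prop} {w : ℕ → V} {n : ℕ} (h : ∀ i < n, R (w i) (w (i + 1))) :
    ∀ i j, i < j → j ≤ n → TransGen R (w i) (w j) := by
  intro i j hij hj
  exact TransGen.head' (h i (by omega)) (rtg_path h (i + 1) j hij hj)

/-- a relation with a cycle has a minimal periodic one -/
theorem exists_min_cycle {R : V → V → Prop} (hirr : ∀ x, ¬ R x x) {v : V} (hv : TransGen R v v) :
    ∃ (n : ℕ) (w : ℤ → V), 0 < n ∧ (∀ i j : ℤ, w i = w j ↔ (n : ℤ) ∣ j - i) ∧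
      (∀ i, R (w i) (w (i + 1))) ∧ (∀ i j, R (w i) (w j) → (n : ℤ) ∣ j - i - 1) := by
  classical
  have hex : ∃ n : ℕ, 0 < n ∧ ∃ w : ℕ → V, w n = w 0 ∧ ∀ i < n, R (w i) (w (i + 1)) := by
    obtain ⟨n, w, hn, h0, h1, h2⟩ := exists_path hv
    exact ⟨n, hn, w, by rw [h0, h1], h2⟩
  obtain ⟨hn, f, hf, hstep⟩ := Nat.find_spec hex
  have hmin := fun m (h : m < Nat.find hex) => Nat.find_min hex h
  generalize Nat.find hex = n at hn f hf hstep hmin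
  have hn' : (0 : ℤ) < n := by exact_mod_cast hn
  let w : ℤ → V := fun k => f (k % n).toNat
  have hper : ∀ i j : ℤ, (n : ℤ) ∣ j - i → w i = w j := by
    intro i j h
    have : i % n = j % n := (Int.emod_emod_of_dvd _ (dvd_refl _)).symm.trans (by
      rw [Int.emod_emod_of_dvd _ (dvd_refl _)]; exact Int.ModEq.eq ((Int.modEq_iff_dvd).2 h))
    simp only [w, this]
  have hR : ∀ i, R (w i) (w (i + 1)) := by
    intro i
    have h1 := Int.emod_nonneg i hn'.ne'
    have h2 := Int.emod_lt_of_pos i hn'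
    have h3 := hstep (i % n).toNat (by omega)
    have h4 : w (i + 1) = f ((i % n).toNat + 1) := by
      by_cases hl : i % n + 1 = n
      · have e1 : (i % n).toNat + 1 = n := by omega
        rw [e1, hf]
        have : (i + 1) % n = 0 := by rw [← Int.emod_add_emod, hl, Int.emod_self]
        simp only [w, this, Int.toNat_zero]
      · have : (i + 1) % n = i % n + 1 := by
          rw [← Int.emod_add_emod]; exact Int.emod_eq_of_lt (by omega) (by omega)
        simp only [w, this]
        congr 1
        omega
    rw [h4]; exact h3
  refine ⟨n, w, hn, fun i j => ⟨fun h => ?_, hper i j⟩, hR, ?_⟩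
  · have h1 := Int.emod_nonneg (j - i) hn'.ne'
    have h2 := Int.emod_lt_of_pos (j - i) hn'
    by_contra hd
    have h3 : (j - i) % n ≠ 0 := fun h' => hd (Int.dvd_of_emod_eq_zero h')
    refine hmin ((j - i) % n).toNat (by omega) ⟨by omega, fun k => w (i + k), ?_, ?_⟩
    · have : w (i + (((j - i) % n).toNat : ℤ)) = w j := by
        apply hper
        rw [Int.toNat_of_nonneg h1]
        have := Int.mul_ediv_add_emod (j - i) n
        exact ⟨(j - i) / n, by linarith⟩
      simp only [this, Nat.cast_zero, add_zero, h]
    · intro k _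
      have := hR (i + k)
      rw [add_assoc] at this
      exact_mod_cast this
  · intro i j hij
    have h1 := Int.emod_nonneg (j - i) hn'.ne'
    have h2 := Int.emod_lt_of_pos (j - i) hn'
    have hdiv := Int.mul_ediv_add_emod (j - i) n
    by_contra hd
    have h3 : (j - i) % n ≠ 0 := fun h' => by
      rw [hper i j (Int.dvd_of_emod_eq_zero h')] at hij
      exact hirr _ hij
    have h4 : (j - i) % n ≠ 1 := fun h' => hd ⟨(j - i) / n, by linarith⟩
    generalize hdd : (j - i) % n = d at *
    refine hmin (n - d + 1).toNat (by omega)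
      ⟨by omega, fun k => if k = 0 then w i else w (j + k - 1), ?_, ?_⟩
    · have hne : (n - d + 1).toNat ≠ 0 := by omega
      simp only [hne, if_false, if_true]
      apply hper
      rw [Int.toNat_of_nonneg (by omega)]
      exact ⟨- ((j - i) / n) - 1, by linarith⟩
    · intro k _
      by_cases hk : k = 0
      · subst hk
        simpa using hij
      · have := hR (j + k - 1)
        simp only [hk, if_false, Nat.add_eq_zero_iff, one_ne_zero, and_false]
        convert this using 2
        push_cast; ring

theorem reorient_antisymm {A B : Set (V × V)} (hA : IsDAG A) (hB : B ⊆ A) {x y : V}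
    (h1 : (x, y) ∈ reorient A B) (h2 : (y, x) ∈ reorient A B) : False := by
  rw [mem_reorient] at h1 h2
  have := hA.2.1 (x, y)
  simp only [Prod.swap_prod_mk] at this
  have h3 := @hB (x, y)
  have h4 := @hB (y, x)
  tauto

theorem last_arc {A B : Set (V × V)} (hA : IsDAG A) (hB : B ⊆ A) (hcl : Closed A B)
    {n : ℕ} {w : ℤ → V} (hn : 3 ≤ n) (hper : ∀ i j : ℤ, w i = w j ↔ (n : ℤ) ∣ j - i)
    (hR : ∀ i, (w i, w (i + 1)) ∈ reorient A B)
    (hch : ∀ i j, (w i, w j) ∈ reorient A B → (n : ℤ) ∣ j - i - 1)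
    (ha : (w (-1), w 0) ∈ A) (hnB : (w (-1), w 0) ∉ B) :
    (w (-1), w 0) ∈ transRed (inducedArcs A (Set.range w)) := by
  refine ⟨⟨ha, ⟨_, rfl⟩, ⟨_, rfl⟩⟩, ?_⟩
  rintro ⟨z, hz1, hz2⟩
  apply hnB
  have hAsub := induced_subset A (Set.range w)
  have hnb : ∀ i j, (w i, w j) ∈ A → w j = w (i + 1) ∨ w j = w (i - 1) := by
    intro i j hij
    by_cases hb : (w i, w j) ∈ B
    · right
      obtain ⟨c, hc⟩ := hch j i (mem_reorient.2 (Or.inr hb))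
      exact (hper _ _).2 ⟨c, by linarith⟩
    · left
      obtain ⟨c, hc⟩ := hch i j (mem_reorient.2 (Or.inl ⟨hij, hb⟩))
      exact (hper _ _).2 ⟨-c, by linarith⟩
  have main : ∀ k : ℕ, k + 2 ≤ n →
      ((w (-1 - k), w (-2 - k)) ∈ A ∧
        ReflTransGen (ArcRel (inducedArcs A (Set.range w))) (w (-2 - k)) (w 0)) := by
    intro k
    induction k with
    | zero =>
      intro _
      obtain ⟨m, rfl⟩ := hz1.2.2
      have e1 : (-1 - ((0 : ℕ) : ℤ)) = -1 := by simp
      have e2 : (-2 - ((0 : ℕ) : ℤ)) = -1 - 1 := by simp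
      rw [e1, e2]
      rcases hnb _ _ hz1.1 with h | h
      · rw [show (-1 : ℤ) + 1 = 0 by norm_num] at h
        simp only at hz2
        rw [h] at hz2
        exact (hA.2.2 _ (tg_mono hAsub hz2)).elim
      · rw [← h]
        exact ⟨hz1.1, hz2.to_reflTransGen⟩
    | succ k ih =>
      intro hk
      obtain ⟨h1, h2⟩ := ih (by omega)
      have hne : w (-2 - k) ≠ w 0 := by
        intro h
        have h3 := (hper _ _).1 h
        have h4 := Int.le_of_dvd (by omega) h3
        push_cast at h4
        omega
      rcases ReflTransGen.cases_head h2 with h | ⟨c, h3, h4⟩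
      · exact (hne h).elim
      obtain ⟨m, rfl⟩ := h3.2.2
      rcases hnb _ _ h3.1 with h | h
      · exfalso
        rw [show (-2 - (k : ℤ)) + 1 = -1 - k by ring] at h
        have h5 := h3.1
        rw [h] at h5
        exact hA.2.1 _ h1 h5
      · rw [show (-2 - (k : ℤ)) - 1 = -2 - ((k + 1 : ℕ) : ℤ) by push_cast; ring] at h
        rw [← h, show (-1 - ((k + 1 : ℕ) : ℤ)) = -2 - (k : ℤ) by push_cast; ring]
        exact ⟨h3.1, h4⟩
  have inB : ∀ k : ℕ, k + 2 ≤ n → (w (-1 - k), w (-2 - k)) ∈ B := by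
    intro k hk
    have h1 := (main k hk).1
    have h2 := hR (-2 - k)
    rw [show (-2 - (k : ℤ)) + 1 = -1 - k by ring] at h2
    rcases mem_reorient.1 h2 with h | h
    · exact (hA.2.1 _ h1 h.1).elim
    · exact h
  have path : ∀ k : ℕ, k + 2 ≤ n → TransGen (ArcRel B) (w (-1)) (w (-2 - k)) := by
    intro k
    induction k with
    | zero =>
      intro hk
      have := inB 0 hk
      simp only [Nat.cast_zero, sub_zero] at this ⊢
      exact .single this
    | succ k ih =>
      intro hk
      refine (ih (by omega)).tail ?_
      have := inB (k + 1) hk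
      rw [show (-1 - ((k + 1 : ℕ) : ℤ)) = -2 - (k : ℤ) by push_cast; ring] at this
      exact this
  refine hcl _ _ ha ?_
  have := path (n - 2) (by omega)
  rwa [show w (-2 - ((n - 2 : ℕ) : ℤ)) = w 0 from (hper _ _).2 ⟨1, by omega⟩] at this

theorem armem_of_biclosed {A B : Set (V × V)} (hA : IsDAG A) (hV : Vertebrate A) (hB : B ⊆ A)
    (h1 : Closed A B) (h2 : Closed A (A \ B)) : ARmem A B := by
  refine ⟨hB, fun v hv => ?_⟩
  obtain ⟨n, w, hn, hper, hR, hch⟩ := exists_min_cycle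
    (R := ArcRel (reorient A B))
    (fun x hx => reorient_antisymm hA hB hx hx) hv
  have hn3 : 3 ≤ n := by
    by_contra hlt
    have : n = 1 ∨ n = 2 := by omega
    rcases this with rfl | rfl
    · have h := hR 0
      rw [(hper (0 + 1) 0).2 (by simp)] at h
      exact reorient_antisymm hA hB h h
    · have h := hR 0
      have h' := hR (0 + 1)
      rw [(hper (0 + 1 + 1) 0).2 (by simp)] at h'
      exact reorient_antisymm hA hB h h'
  have hn0 : (3 : ℤ) ≤ n := by exact_mod_cast hn3
  have allT : ∀ i, (w i, w (i + 1)) ∈ transRed (inducedArcs A (Set.range w)) ∨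
      (w (i + 1), w i) ∈ transRed (inducedArcs A (Set.range w)) := by
    intro i
    rcases mem_reorient.1 (hR i) with h | h
    · left
      have hr : Set.range (fun k => w (i + 1 + k)) = Set.range w :=
        (Equiv.addLeft (i + 1)).surjective.range_comp w
      have := last_arc (w := fun k => w (i + 1 + k)) hA hB h1 hn3
        (fun a b => by simp only [hper]; rw [show i + 1 + b - (i + 1 + a) = b - a by ring])
        (fun a => by
          have := hR (i + 1 + a)
          rwa [add_assoc (i + 1) a 1] at this)
        (fun a b hab => by
          have := hch _ _ hab
          rwa [show i + 1 + b - (i + 1 + a) - 1 = b - a - 1 by ring] at this)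
        (by simpa using h.1) (by simpa using h.2)
      rw [hr] at this
      simpa using this
    · right
      have hr : Set.range (fun k => w (i - k)) = Set.range w :=
        (Equiv.subLeft i).surjective.range_comp w
      have := last_arc (B := A \ B) (w := fun k => w (i - k)) hA Set.diff_subset h2 hn3
        (fun a b => by
          simp only [hper]
          rw [show i - b - (i - a) = - (b - a) by ring, dvd_neg])
        (fun a => by
          rw [mem_reorient_compl hB]
          have := hR (i - (a + 1))
          rwa [show i - (a + 1) + 1 = i - a by ring] at this)
        (fun a b hab => by
          rw [mem_reorient_compl hB] at hab
          have := hch _ _ hab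
          rwa [show i - a - (i - b) - 1 = b - a - 1 by ring] at this)
        (by simpa using hB h) (by simpa using fun _ => h)
      rw [hr] at this
      simpa using this
  have hne : ∀ i, w i ≠ w (i + 1) := fun i h => by
    have := Int.le_of_dvd (by omega) ((hper _ _).1 h)
    omega
  refine bridge (hV (Set.range w)) (hne 0) (allT 0) ?_
  have walk : ∀ k : ℕ, k < n →
      ((undirectedGraph (transRed (inducedArcs A (Set.range w)))) \
        SimpleGraph.fromEdgeSet {s(w 0, w (0 + 1))}).Reachable (w (0 + 1)) (w (k + 1)) := by
    intro k
    induction k with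
    | zero => intro _; exact SimpleGraph.Reachable.refl _
    | succ k ih =>
      intro hk
      refine (ih (by omega)).trans ?_
      have e : ((k + 1 : ℕ) : ℤ) + 1 = (k : ℤ) + 1 + 1 := by push_cast; ring
      rw [e]
      refine bridge_step (hne _) (allT _) ?_
      intro hs
      rcases Sym2.eq_iff.1 hs with ⟨h, _⟩ | ⟨h, h'⟩
      · have := Int.le_of_dvd (by omega) ((hper _ _).1 h.symm)
        omega
      · have := Int.le_of_dvd (by omega) ((hper _ _).1 h'.symm)
        have hk2 : (k : ℤ) + 1 + 1 = n := by omega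
        have := Int.le_of_dvd (by omega) ((hper _ _).1 h.symm)
        omega
  have := walk (n - 1) (by omega)
  rw [show w (((n - 1 : ℕ) : ℤ) + 1) = w 0 from (hper _ _).2 ⟨-1, by omega⟩] at this
  exact this.symm

theorem clo_armem [Fintype V] {A B C : Set (V × V)} (hA : IsDAG A) (hV : Vertebrate A)
    (hB : ARmem A B) (hC : ARmem A C) : ARmem A (clo A (B ∪ C)) :=
  armem_of_biclosed hA hV (fun _ h => h.1) (clo_closed _ _)
    (clo_coclosed hA hV hB.1 hC.1 (armem_closed (armem_compl hB)) (armem_closed (armem_compl hC)))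

theorem clo_join [Fintype V] {A B C : Set (V × V)} (hA : IsDAG A) (hV : Vertebrate A)
    (hB : ARmem A B) (hC : ARmem A C) : IsJoinAR A B C (clo A (B ∪ C)) := by
  have hs := subset_clo (Set.union_subset hB.1 hC.1)
  refine ⟨clo_armem hA hV hB hC, Set.subset_union_left.trans hs,
    Set.subset_union_right.trans hs, ?_⟩
  rintro w hw h1 h2 ⟨a, b⟩ hab
  exact armem_closed hw a b hab.1 (tg_mono (Set.union_subset h1 h2) hab.2)

theorem armem_restrict {A A' B : Set (V × V)} (hsub : A' ⊆ A) (hB : ARmem A B) :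
    ARmem A' (B ∩ A') := by
  refine ⟨Set.inter_subset_right, acyclic_mono ?_ hB.2⟩
  rintro ⟨x, y⟩ h
  rw [mem_reorient] at h ⊢
  rcases h with h | h
  · exact Or.inl ⟨hsub h.1, fun h' => h.2 ⟨h', h.1⟩⟩
  · exact Or.inr h.1

def PathfulN (A A' : Set (V × V)) : Prop :=
  ∀ (n : ℕ) (w : ℕ → V), (∀ i < n, (w i, w (i + 1)) ∈ A) → (w 0, w n) ∈ A' →
    ∀ i < n, (w i, w (i + 1)) ∈ A'

theorem pathful_iff {A A' : Set (V × V)} : Pathful A A' ↔ PathfulN A A' := by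
  constructor
  · intro h n w hw h0 i hi
    refine h ((List.range (n + 1)).map w) ?_ (w 0) (w n) ?_ ?_ h0 (w i, w (i + 1)) ?_
    · refine List.isChain_iff_getElem.2 ?_
      intro i hi
      simp only [List.length_map, List.length_range] at hi
      simpa using hw i (by omega)
    · simp [List.range_succ_eq_map]
    · simp [List.range_succ]
    · rw [List.mem_iff_getElem]
      refine ⟨i, by simp; omega, by simp⟩
  · intro h p hp u v hu hv huv a ha
    have hlen : 0 < p.length := by
      cases p with
      | nil => simp at hu
      | cons => simp
    have hp' := List.isChain_iff_getElem.1 hp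
    have hget : ∀ i (hi : i < p.length), p.getD i u = p[i] := by
      intro i hi; simp [hi]
    obtain ⟨i, hi, rfl⟩ := List.mem_iff_getElem.1 ha
    simp only [List.length_zip, List.length_tail] at hi
    have := h (p.length - 1) (fun i => p.getD i u) ?_ ?_ i (by omega)
    · rw [hget i (by omega), hget (i + 1) (by omega)] at this
      simpa using this
    · intro i hi
      rw [hget i (by omega), hget (i + 1) (by omega)]
      exact hp' i (by omega)
    · rw [hget 0 hlen, hget _ (by omega)]
      have e1 : p[0] = u := by
        rw [List.head?_eq_getElem?] at hu
        simpa [hlen] using hu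
      have e2 : p[p.length - 1] = v := by
        rw [List.getLast?_eq_getElem?] at hv
        rw [List.getElem?_eq_getElem (by omega)] at hv
        simpa using hv
      rw [e1, e2]; exact huv

theorem join_hom [Fintype V] {A A' : Set (V × V)} (hA : IsDAG A) (hV : Vertebrate A)
    (hsub : A' ⊆ A) (hp : PathfulN A A') {x y j : Set (V × V)} (hx : ARmem A x) (hy : ARmem A y)
    (hj : IsJoinAR A x y j) : IsJoinAR A' (x ∩ A') (y ∩ A') (j ∩ A') := by
  refine ⟨armem_restrict hsub hj.1, Set.inter_subset_inter_left _ hj.2.1,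
    Set.inter_subset_inter_left _ hj.2.2.1, ?_⟩
  rintro w hw h1 h2 ⟨u, v⟩ ⟨huj, huA⟩
  have hJ := clo_join hA hV hx hy
  have huv := (hj.2.2.2 _ hJ.1 hJ.2.1 hJ.2.2.1 huj).2
  obtain ⟨n, f, hn, h0, hf, hst⟩ := exists_path huv
  simp only at h0 hf
  have hA' := hp n f (fun i hi => (Set.union_subset hx.1 hy.1) (hst i hi)) (by rwa [h0, hf])
  have : TransGen (ArcRel w) (f 0) (f n) := by
    refine tg_path (n := n) ?_ 0 n hn le_rfl
    intro i hi
    rcases hst i hi with h | h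
    · exact h1 ⟨h, hA' i hi⟩
    · exact h2 ⟨h, hA' i hi⟩
  rw [h0, hf] at this
  exact armem_closed hw u v huA this

theorem meet_to_join {A x y m : Set (V × V)} (hx : x ⊆ A) (hy : y ⊆ A)
    (h : IsMeetAR A x y m) : IsJoinAR A (A \ x) (A \ y) (A \ m) := by
  refine ⟨armem_compl h.1, Set.diff_subset_diff_right h.2.1,
    Set.diff_subset_diff_right h.2.2.1, ?_⟩
  intro w hw h1 h2
  have := h.2.2.2 (A \ w) (armem_compl hw)
    (fun a ha => by by_contra hc; exact ha.2 (h1 ⟨ha.1, hc⟩))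
    (fun a ha => by by_contra hc; exact ha.2 (h2 ⟨ha.1, hc⟩))
  intro a ha
  by_contra hc
  exact ha.2 (this ⟨ha.1, hc⟩)

theorem join_to_meet {A x y m : Set (V × V)} (hm : m ⊆ A)
    (h : IsJoinAR A (A \ x) (A \ y) (A \ m)) : IsMeetAR A x y m := by
  have hmm : A \ (A \ m) = m := by rw [Set.diff_diff_cancel_left hm]
  refine ⟨hmm ▸ armem_compl h.1, ?_, ?_, ?_⟩
  · intro a ha
    by_contra hc
    exact (h.2.1 ⟨hm ha, hc⟩).2 ha
  · intro a ha
    by_contra hc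
    exact (h.2.2.1 ⟨hm ha, hc⟩).2 ha
  · intro w hw h1 h2 a ha
    by_contra hc
    exact (h.2.2.2 (A \ w) (armem_compl hw) (Set.diff_subset_diff_right h1)
      (Set.diff_subset_diff_right h2) ⟨hw.1 ha, hc⟩).2 ha

theorem compl_inter {A A' x : Set (V × V)} (hsub : A' ⊆ A) :
    (A \ x) ∩ A' = A' \ (x ∩ A') := by
  ext a
  have := @hsub a
  simp only [Set.mem_inter_iff, Set.mem_diff]
  tauto

theorem meet_hom [Fintype V] {A A' : Set (V × V)} (hA : IsDAG A) (hV : Vertebrate A)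
    (hsub : A' ⊆ A) (hp : PathfulN A A') {x y m : Set (V × V)} (hx : ARmem A x) (hy : ARmem A y)
    (hm : IsMeetAR A x y m) : IsMeetAR A' (x ∩ A') (y ∩ A') (m ∩ A') := by
  have := join_hom hA hV hsub hp (armem_compl hx) (armem_compl hy) (meet_to_join hx.1 hy.1 hm)
  rw [compl_inter hsub, compl_inter hsub, compl_inter hsub] at this
  exact join_to_meet Set.inter_subset_right this

def Bset (A : Set (V × V)) (x y : V) : Set (V × V) :=
  {a ∈ A | a.2 = y ∧ ReflTransGen (ArcRel A) x a.1}

theorem Bset_armem {A : Set (V × V)} (hA : IsDAG A) (hV : Vertebrate A) (x y : V) :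
    ARmem A (Bset A x y) := by
  refine armem_of_biclosed hA hV (fun _ h => h.1) ?_ ?_
  · intro u v huv h
    obtain ⟨c, h1, _⟩ := TransGen.head'_iff.1 h
    obtain ⟨d, _, h2⟩ := TransGen.tail'_iff.1 h
    exact ⟨huv, h2.2.1, h1.2.2⟩
  · intro u v huv h
    refine ⟨huv, fun hB => ?_⟩
    obtain ⟨d, h1, h2⟩ := TransGen.tail'_iff.1 h
    exact h2.2 ⟨h2.1, hB.2.1, hB.2.2.trans (rtg_mono Set.diff_subset h1)⟩

theorem empty_armem {A : Set (V × V)} (hA : IsDAG A) : ARmem A ∅ := by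
  refine ⟨Set.empty_subset _, acyclic_mono ?_ hA.2.2⟩
  rintro ⟨x, y⟩ h
  rcases mem_reorient.1 h with h | h
  · exact h.1
  · exact h.elim

theorem hom_pathful [Fintype V] {A A' : Set (V × V)} (hA : IsDAG A) (hA' : IsDAG A')
    (hsub : A' ⊆ A) (hV : Vertebrate A) (hV' : Vertebrate A')
    (hom : ∀ x y j, ARmem A x → ARmem A y → IsJoinAR A x y j →
        IsJoinAR A' (x ∩ A') (y ∩ A') (j ∩ A')) : PathfulN A A' := by
  intro n w hw h0
  have joins : ∀ k : ℕ, ∃ J K, ARmem A J ∧ ARmem A' K ∧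
      (∀ i < k, Bset A (w i) (w (i + 1)) ⊆ J) ∧ J ∩ A' ⊆ K ∧
      ∀ a ∈ K, TransGen (ArcRel {b ∈ A' | ∃ i < k, b ∈ Bset A (w i) (w (i + 1))}) a.1 a.2 := by
    intro k
    induction k with
    | zero => exact ⟨∅, ∅, empty_armem hA, empty_armem hA', by simp, by simp, by simp⟩
    | succ k ih =>
      obtain ⟨J, K, hJ, hK, h1, h2, h3⟩ := ih
      have hB := Bset_armem hA hV (w k) (w (k + 1))
      have hB' := armem_restrict hsub hB
      have hj := clo_join hA hV hJ hB
      have hk := clo_join hA' hV' hK hB'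
      refine ⟨_, _, hj.1, hk.1, ?_, ?_, ?_⟩
      · intro i hi
        rcases Nat.lt_succ_iff_lt_or_eq.1 hi with h | rfl
        · exact (h1 i h).trans hj.2.1
        · exact hj.2.2.1
      · exact (hom _ _ _ hJ hB hj).2.2.2 _ hk.1 (h2.trans hk.2.1) hk.2.2.1
      · intro a ha
        have h4 := ha.2
        clear ha
        have step : ∀ b c, (b, c) ∈ K ∪ (Bset A (w k) (w (k + 1)) ∩ A') →
            TransGen (ArcRel {b ∈ A' | ∃ i < k + 1, b ∈ Bset A (w i) (w (i + 1))}) b c := by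
          rintro b c (h | h)
          · exact tg_mono (E := {b ∈ A' | ∃ i < k, b ∈ Bset A (w i) (w (i + 1))})
              (F := {b ∈ A' | ∃ i < k + 1, b ∈ Bset A (w i) (w (i + 1))}) (fun a ha => ⟨ha.1, by
              obtain ⟨i, hi, h⟩ := ha.2
              exact ⟨i, by omega, h⟩⟩) (h3 _ h)
          · exact .single ⟨h.2, k, by omega, h.1⟩
        generalize a.1 = s at h4
        generalize a.2 = t at h4
        induction h4 with
        | single h => exact step _ _ h
        | tail _ h ih => exact ih.trans (step _ _ h)
  obtain ⟨J, K, hJ, hK, h1, h2, h3⟩ := joins n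
  intro i hi
  have hn : 0 < n := by omega
  have hJuv : (w 0, w n) ∈ J := by
    refine armem_closed hJ _ _ (hsub h0) (tg_path (n := n) ?_ 0 n hn le_rfl)
    intro i hi
    exact h1 i hi ⟨hw i hi, rfl, .refl⟩
  have hp := h3 _ (h2 ⟨hJuv, h0⟩)
  have hord : ∀ i j, i < j → j ≤ n → TransGen (ArcRel A) (w i) (w j) := tg_path hw
  have inj : ∀ i j, i ≤ n → j ≤ n → w i = w j → i = j := by
    intro i j hi hj h
    rcases lt_trichotomy i j with h' | h' | h'
    · exact (hA.2.2 _ (h ▸ hord i j h' hj)).elim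
    · exact h'
    · exact (hA.2.2 _ (h ▸ hord j i h' hi)).elim
  have claim : ∀ t, ReflTransGen
      (ArcRel {b ∈ A' | ∃ i < n, b ∈ Bset A (w i) (w (i + 1))}) (w 0) t →
      ∃ k ≤ n, t = w k ∧ ∀ i < k, (w i, w (i + 1)) ∈ A' := by
    intro t ht
    induction ht with
    | refl => exact ⟨0, by omega, rfl, by simp⟩
    | @tail s t _ hst ih =>
      obtain ⟨k, hk, rfl, hall⟩ := ih
      obtain ⟨hst', i, hi, hB⟩ := hst
      have e : t = w (i + 1) := hB.2.1
      subst e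
      have hki : k = i := by
        rcases lt_trichotomy k i with h | h | h
        · exact (hA.2.2 _ ((hord k i h hi.le).trans_left hB.2.2)).elim
        · exact h
        · exfalso
          have := rtg_path (R := ArcRel A) hw (i + 1) k h hk
          exact hA.2.2 _ (TransGen.head' hB.1 this)
      subst hki
      refine ⟨k + 1, hi, rfl, ?_⟩
      intro j hj
      rcases Nat.lt_succ_iff_lt_or_eq.1 hj with h | rfl
      · exact hall j h
      · exact hst'
  obtain ⟨k, hk, he, hall⟩ := claim _ hp.to_reflTransGen
  have : n = k := inj _ _ le_rfl hk he
  subst this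
  exact hall i hi

end Stmt8

/-- For vertebrate `D` and `D'`, the restriction map
`ρ(B) = B ∩ A'` is a lattice homomorphism if and only if `A'` is pathful in `A`. -/
theorem stmt_8 {V : Type*} [Fintype V] (A A' : Set (V × V)) (hA : IsDAG A)
    (hA' : IsDAG A') (hsub : A' ⊆ A) (hV : Vertebrate A) (hV' : Vertebrate A') :
    ((∀ x y j, ARmem A x → ARmem A y → IsJoinAR A x y j →
        IsJoinAR A' (x ∩ A') (y ∩ A') (j ∩ A')) ∧
      (∀ x y m, ARmem A x → ARmem A y → IsMeetAR A x y m →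
        IsMeetAR A' (x ∩ A') (y ∩ A') (m ∩ A'))) ↔ Pathful A A' := by
  rw [Stmt8.pathful_iff]
  constructor
  · exact fun h => Stmt8.hom_pathful hA hA' hsub hV hV' h.1
  · exact fun h => ⟨fun x y j hx hy hj => Stmt8.join_hom hA hV hsub h hx hy hj,
      fun x y m hx hy hm => Stmt8.meet_hom hA hV hsub h hx hy hm⟩
end

section
/- Let D = (V, A) be a directed acyclic graph. The acyclic reorientation poset AR(D) is a semidistributive lattice — a lattice in which x ∨ y = x ∨ z implies x ∨ (y ∧ z) = x ∨ y, and x ∧ y = x ∧ z implies x ∧ (y ∨ z) = x ∧ y, for all x, y, z — if and only if D is skeletal. -/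
/-- For every directed path from `u` to `v` with `(u,v) ∈ A`, any two vertices of
the path are joined by an arc of `A`. -/
def Filled {V : Type*} (A : Set (V × V)) : Prop :=
  ∀ p : List V, p.Chain' (fun x y => (x, y) ∈ A) →
    ∀ u v : V, p.head? = some u → p.getLast? = some v → (u, v) ∈ A →
      ∀ x ∈ p, ∀ y ∈ p, x ≠ y → ((x, y) ∈ A ∨ (y, x) ∈ A)

def Skeletal {V : Type*} (A : Set (V × V)) : Prop := Vertebrate A ∧ Filled A


section RelSection

open Relation

lemma acyclic_of_rank {V : Type*} {A E : Set (V × V)} (hA : AcyclicArcs A) (g : V → ℕ)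
    (h : ∀ a b, (a, b) ∈ E → g a < g b ∨ (g a = g b ∧ (a, b) ∈ A)) : AcyclicArcs E := by
  have key : ∀ a b, TransGen (ArcRel E) a b →
      g a < g b ∨ (g a = g b ∧ TransGen (ArcRel A) a b) := by
    intro a b hab
    induction hab with
    | single h1 =>
      rcases h _ _ h1 with h2 | ⟨h2, h3⟩
      · exact Or.inl h2
      · exact Or.inr ⟨h2, .single h3⟩
    | tail _ h1 ih =>
      rcases h _ _ h1 with h2 | ⟨h2, h3⟩ <;> rcases ih with h4 | ⟨h4, h5⟩
      · left; omega
      · left; omega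
      · left; omega
      · right; exact ⟨by omega, h5.tail h3⟩
  intro v hv
  rcases key v v hv with h1 | ⟨_, h1⟩
  · omega
  · exact hA v h1

/-- the reorientation given by a rank function -/
def rankSet {V : Type*} (A : Set (V × V)) (g : V → ℕ) : Set (V × V) := {a ∈ A | g a.2 < g a.1}

lemma rankSet_mem {V : Type*} {A : Set (V × V)} (hA : IsDAG A) (g : V → ℕ) :
    ARmem A (rankSet A g) := by
  refine ⟨fun a h => h.1, acyclic_of_rank hA.2.2 g ?_⟩
  rintro a b (⟨h1, h2⟩ | ⟨⟨c, d⟩, ⟨_, h2⟩, h3⟩)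
  · simp only [rankSet, Set.mem_ofPred_eq, not_and, not_lt] at h2
    have := h2 h1
    rcases this.lt_or_eq with h | h
    · exact Or.inl h
    · exact Or.inr ⟨h, h1⟩
  · simp only [Prod.swap_prod_mk, Prod.mk.injEq] at h3
    obtain ⟨rfl, rfl⟩ := h3
    exact Or.inl h2

lemma mem_reorient {V : Type*} {A B : Set (V × V)} {a b : V} :
    (a, b) ∈ reorient A B ↔ ((a, b) ∈ A ∧ (a, b) ∉ B) ∨ (b, a) ∈ B := by
  simp [reorient]

lemma compl_mem {V : Type*} {A B : Set (V × V)} (hB : ARmem A B) : ARmem A (A \ B) := by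
  refine ⟨Set.sdiff_subset, fun v hv => hB.2 v ?_⟩
  have : ∀ a b, TransGen (ArcRel (reorient A (A \ B))) a b →
      TransGen (ArcRel (reorient A B)) b a := by
    intro a b h
    rw [← transGen_swap]
    refine TransGen.mono (fun x y hxy => ?_) _ _ h
    simp only [ArcRel, mem_reorient, Function.swap, Set.mem_sdiff] at *
    have := @hB.1
    grind
  exact this v v hv

/-- complement -/
def co {V : Type*} {A : Set (V × V)} (x : ARP A) : ARP A := ⟨A \ x.1, compl_mem x.2⟩

lemma co_co {V : Type*} {A : Set (V × V)} (x : ARP A) : co (co x) = x :=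
  Subtype.ext (by simpa [co] using x.2.1)

lemma co_le {V : Type*} {A : Set (V × V)} {x y : ARP A} : co x ≤ co y ↔ y ≤ x := by
  have key : ∀ x y : ARP A, y ≤ x → co x ≤ co y := by
    intro x y h a ha
    exact ⟨ha.1, fun h1 => ha.2 (h h1)⟩
  refine ⟨fun h => ?_, key x y⟩
  simpa [co_co] using key _ _ h

lemma isLUB_co {V : Type*} {A : Set (V × V)} {x y m : ARP A} :
    IsLUB {co x, co y} (co m) ↔ IsGLB {x, y} m := by
  simp only [isLUB_iff_le_iff, isGLB_iff_le_iff, upperBounds_insert, upperBounds_singleton,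
    lowerBounds_insert, lowerBounds_singleton, Set.mem_inter_iff, Set.mem_Ici, Set.mem_Iic]
  constructor
  · intro h b
    simpa [co_le] using h (co b)
  · intro h b
    have := h (co b)
    rw [← co_co b]
    simpa [co_le] using this

/-- closure property equivalent to being filled -/
def StarP {V : Type*} (A : Set (V × V)) : Prop :=
  ∀ u m v, TransGen (ArcRel A) u m → TransGen (ArcRel A) m v → (u, v) ∈ A →
    (u, m) ∈ A ∧ (m, v) ∈ A

lemma filled_star {V : Type*} {A : Set (V × V)} (hA : IsDAG A) (h : Filled A) : StarP A := by
  intro u m v hum hmv huv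
  have h1 : ∃ p : List V, p.IsChain (fun x y => (x, y) ∈ A) ∧ p.head? = some m ∧
      p.getLast? = some v ∧ m ∈ p := by
    clear hum huv
    induction hmv using TransGen.head_induction_on with
    | single h => exact ⟨[_, v], by simpa [ArcRel] using h, by simp, by simp, by simp⟩
    | head h1 _ ih =>
      obtain ⟨p, h2, h3, h4, h5⟩ := ih
      refine ⟨_ :: p, ?_, rfl, ?_, by simp⟩
      · rw [List.isChain_cons]
        refine ⟨?_, h2⟩
        intro y hy
        rw [h3] at hy
        simp at hy
        subst hy
        exact h1
      · rw [List.getLast?_cons, h4]; rfl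
  have h2 : ∃ p : List V, p.IsChain (fun x y => (x, y) ∈ A) ∧ p.head? = some u ∧
      p.getLast? = some v ∧ m ∈ p := by
    have hum' := hum.to_reflTransGen
    clear hum huv
    induction hum' using ReflTransGen.head_induction_on with
    | refl => exact h1
    | head h1 _ ih =>
      obtain ⟨p, h2, h3, h4, h5⟩ := ih
      refine ⟨_ :: p, ?_, rfl, ?_, by simp [h5]⟩
      · rw [List.isChain_cons]
        refine ⟨?_, h2⟩
        intro y hy
        rw [h3] at hy
        simp at hy
        subst hy
        exact h1
      · rw [List.getLast?_cons, h4]; rfl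
  obtain ⟨p, hp, hu, hv, hm⟩ := h2
  have key := h p hp u v hu hv huv
  have hup : u ∈ p := List.mem_of_mem_head? hu
  have hvp : v ∈ p := List.mem_of_getLast? hv
  have ac := hA.2.2
  constructor
  · rcases key u hup m hm (by rintro rfl; exact ac _ hum) with h3 | h3
    · exact h3
    · exact absurd (hum.tail h3) (ac _)
  · rcases key m hm v hvp (by rintro rfl; exact ac _ hmv) with h3 | h3
    · exact h3
    · exact absurd (hmv.tail h3) (ac _)

lemma starP_filled {V : Type*} {A : Set (V × V)} (h : StarP A) : Filled A := by
  intro p hp u v hu hv huv x hx y hy hxy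
  have hpw : p.Pairwise (TransGen (ArcRel A)) :=
    List.IsChain.pairwise (List.IsChain.imp (fun a b h => TransGen.single h) hp)
  have hxu : ∀ x ∈ p, x = u ∨ TransGen (ArcRel A) u x := by
    intro x hx
    cases p with
    | nil => simp at hx
    | cons a l =>
      simp at hu; subst hu
      rcases List.mem_cons.1 hx with h1 | h1
      · exact Or.inl h1
      · exact Or.inr ((List.pairwise_cons.1 hpw).1 x h1)
  have hxv : ∀ x ∈ p, x = v ∨ TransGen (ArcRel A) x v := by
    intro x hx
    obtain ⟨l, rfl⟩ := List.getLast?_eq_some_iff.1 hv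
    rw [List.pairwise_append] at hpw
    rcases List.mem_append.1 hx with h1 | h1
    · exact Or.inr (hpw.2.2 x h1 v (by simp))
    · left; simpa using h1
  have main : ∀ x ∈ p, ∀ y ∈ p, TransGen (ArcRel A) x y → (x, y) ∈ A := by
    intro x hx y hy hxy
    have h1 : (x, v) ∈ A := by
      rcases hxu x hx with rfl | h1
      · exact huv
      · rcases hxv x hx with rfl | h2
        · rcases hxv y hy with rfl | h3
          · exact (h _ _ _ (h1) (hxy) huv).2
          · exact (h _ _ _ h1 (hxy.trans h3) huv).2
        · exact (h _ _ _ h1 h2 huv).2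
    rcases hxv y hy with rfl | h3
    · exact h1
    · exact (h _ _ _ hxy h3 h1).1
  have hs : ∀ x ∈ p, ∀ y ∈ p, x ≠ y → (TransGen (ArcRel A) x y ∨ TransGen (ArcRel A) y x) := by
    have : p.Pairwise (fun x y => TransGen (ArcRel A) x y ∨ TransGen (ArcRel A) y x) :=
      hpw.imp (fun h => Or.inl h)
    intro x hx y hy hxy
    have : Std.Symm (fun x y => TransGen (ArcRel A) x y ∨ TransGen (ArcRel A) y x) :=
      ⟨fun _ _ h => h.symm⟩
    exact List.Pairwise.forall ‹_› hx hy hxy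
  rcases hs x hx y hy hxy with h1 | h1
  · exact Or.inl (main _ hx _ hy h1)
  · exact Or.inr (main _ hy _ hx h1)

lemma tri_closed {V : Type*} {A B : Set (V × V)} (hB : ARmem A B) {a b c : V}
    (h1 : (a, b) ∈ B) (h2 : (b, c) ∈ B) (h3 : (a, c) ∈ A) : (a, c) ∈ B := by
  by_contra h
  refine hB.2 a (((TransGen.single (b := c) ?_).tail (c := b) ?_).tail ?_) <;>
    simp only [ArcRel, mem_reorient] <;> tauto

lemma tri_coclosed {V : Type*} {A B : Set (V × V)} (hB : ARmem A B) {a b c : V}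
    (h1 : (a, b) ∈ A) (h2 : (b, c) ∈ A) (h3 : (a, c) ∈ B) : (a, b) ∈ B ∨ (b, c) ∈ B := by
  by_contra! h
  refine hB.2 a (((TransGen.single (b := b) ?_).tail (c := c) ?_).tail ?_) <;>
    simp only [ArcRel, mem_reorient] <;> tauto

lemma adj_undirected {V : Type*} {E : Set (V × V)} {a b : V} :
    (undirectedGraph E).Adj a b ↔ a ≠ b ∧ ((a, b) ∈ E ∨ (b, a) ∈ E) := by
  simp [undirectedGraph]

lemma transGen_induced {V : Type*} {A : Set (V × V)} {U : Set V} {a b : V}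
    (h : TransGen (ArcRel (inducedArcs A U)) a b) : TransGen (ArcRel A) a b :=
  TransGen.mono (fun _ _ h => h.1) _ _ h

lemma no_diamond {V : Type*} {A : Set (V × V)} (hA : IsDAG A) (hV : Vertebrate A) {u x w v : V}
    (h1 : (u, x) ∈ A) (h2 : (x, v) ∈ A) (h3 : (u, w) ∈ A) (h4 : (w, v) ∈ A) :
    x = w ∨ (x, w) ∈ A ∨ (w, x) ∈ A := by
  by_contra! hcon
  obtain ⟨hne, hxw, hwx⟩ := hcon
  obtain ⟨hl, hs, ac⟩ := hA
  have loop : ∀ a, (a, a) ∉ A := fun a h => hl _ h rfl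
  have two : ∀ a b, (a, b) ∈ A → (b, a) ∉ A := fun a b h => hs _ h
  set U : Set V := {u, x, w, v} with hU
  have hmem : ∀ t, t ∈ U ↔ t = u ∨ t = x ∨ t = w ∨ t = v := by intro t; simp [hU]
  -- the four arcs are in the transitive reduction
  have first : ∀ x w, (u, x) ∈ A → (x, v) ∈ A → (u, w) ∈ A → (w, v) ∈ A → x ∈ U →
      (∀ t ∈ U, t = u ∨ t = x ∨ t = w ∨ t = v) → (x, w) ∉ A → (w, x) ∉ A → 
      (u, x) ∈ transRed (inducedArcs A U) ∧ (x, v) ∈ transRed (inducedArcs A U) := by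
    intro x w h1 h2 h3 h4 hxU hUU hxw hwx
    have hu : u ∈ U := by simp [hU]
    have hv : v ∈ U := by simp [hU]
    constructor
    · refine ⟨⟨h1, hu, hxU⟩, ?_⟩
      rintro ⟨t, ht, ht2⟩
      rcases hUU t ht.2.2 with rfl | rfl | rfl | rfl
      · exact loop _ ht.1
      · exact ac _ (transGen_induced ht2)
      · obtain ⟨s, hs1, hs2⟩ := TransGen.tail'_iff.1 ht2
        have hr : TransGen (ArcRel A) u s :=
          TransGen.head' h3 (ReflTransGen.mono (fun _ _ h => h.1) _ _ hs1)
        rcases hUU s hs2.2.1 with rfl | rfl | rfl | rfl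
        · exact ac _ hr
        · exact loop _ hs2.1
        · exact hwx hs2.1
        · exact two _ _ h2 hs2.1
      · exact ac _ ((transGen_induced ht2).tail h2)
    · refine ⟨⟨h2, hxU, hv⟩, ?_⟩
      rintro ⟨t, ht, ht2⟩
      rcases hUU t ht.2.2 with rfl | rfl | rfl | rfl
      · exact two _ _ h1 ht.1
      · exact loop _ ht.1
      · exact hxw ht.1
      · exact ac _ (transGen_induced ht2)
  have f1 := first x w h1 h2 h3 h4 (by simp [hU]) (fun t ht => (hmem t).1 ht) hxw hwx
  have f2 := first w x h3 h4 h1 h2 (by simp [hU]) (fun t ht => by have := (hmem t).1 ht; tauto) hwx hxw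
  have hac := hV U
  rw [IsForestArcs, SimpleGraph.isAcyclic_iff_forall_adj_isBridge] at hac
  have nux : u ≠ x := fun h => loop x (h ▸ h1)
  have nxv : x ≠ v := fun h => loop x (h ▸ h2)
  have nuw : u ≠ w := fun h => loop w (h ▸ h3)
  have nwv : w ≠ v := fun h => loop w (h ▸ h4)
  have nuv : u ≠ v := by rintro rfl; exact two _ _ h1 h2
  have hb := hac (adj_undirected.2 ⟨nux, Or.inl f1.1⟩)
  rw [SimpleGraph.isBridge_iff] at hb
  refine hb ?_
  have r1 : ((undirectedGraph (transRed (inducedArcs A U))).deleteEdges {s(u, x)}).Adj u w := by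
    rw [SimpleGraph.deleteEdges_adj]
    exact ⟨adj_undirected.2 ⟨nuw, Or.inl f2.1⟩, by simp; grind⟩
  have r2 : ((undirectedGraph (transRed (inducedArcs A U))).deleteEdges {s(u, x)}).Adj w v := by
    rw [SimpleGraph.deleteEdges_adj]
    exact ⟨adj_undirected.2 ⟨nwv, Or.inl f2.2⟩, by simp; grind⟩
  have r3 : ((undirectedGraph (transRed (inducedArcs A U))).deleteEdges {s(u, x)}).Adj v x := by
    rw [SimpleGraph.deleteEdges_adj]
    exact ⟨adj_undirected.2 ⟨nxv.symm, Or.inr f1.2⟩, by simp; grind⟩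
  exact (r1.reachable.trans r2.reachable).trans r3.reachable

/-- a periodic closed walk -/
def CWalk {V : Type*} (E : Set (V × V)) (n : ℕ) (c : ℕ → V) : Prop :=
  0 < n ∧ (∀ t, c (t + n) = c t) ∧ ∀ t, (c t, c (t + 1)) ∈ E

/-- make a closed walk out of a finite walk that closes up -/
lemma cwalk_mk {V : Type*} {E : Set (V × V)} (n : ℕ) (c : ℕ → V)
    (h : ∀ i < n, (c i, c (i + 1)) ∈ E) (hc : (c n, c 0) ∈ E) :
    CWalk E (n + 1) (fun t => c (t % (n + 1))) := by
  refine ⟨by omega, fun t => by simp, fun t => ?_⟩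
  have h1 : t % (n + 1) < n + 1 := Nat.mod_lt _ (by omega)
  rcases Nat.lt_or_ge (t % (n + 1)) n with h2 | h2
  · have : (t + 1) % (n + 1) = t % (n + 1) + 1 := by
      rw [Nat.add_mod, Nat.mod_eq_of_lt (a := 1) (by omega), Nat.mod_eq_of_lt (by omega)]
    simp only [this]
    exact h _ h2
  · have h3 : t % (n + 1) = n := by omega
    have : (t + 1) % (n + 1) = 0 := by
      rw [Nat.add_mod, h3]
      rcases n with _ | n
      · simp
      · rw [Nat.mod_eq_of_lt (a := 1) (by omega)]; simp
    simp only [this, h3]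
    exact hc

lemma walk_of_reflTransGen {V : Type*} {E : Set (V × V)} {a b : V}
    (h : ReflTransGen (ArcRel E) a b) :
    ∃ (n : ℕ) (c : ℕ → V), c 0 = a ∧ c n = b ∧ ∀ i < n, (c i, c (i + 1)) ∈ E := by
  induction h with
  | refl => exact ⟨0, fun _ => a, rfl, rfl, by simp⟩
  | @tail x y _ h1 ih =>
    obtain ⟨n, c, h2, h3, h4⟩ := ih
    refine ⟨n + 1, fun i => if i ≤ n then c i else y, by simpa using h2, by simp, ?_⟩
    intro i hi
    rcases Nat.lt_or_ge i n with h5 | h5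
    · simpa [h5.le, Nat.succ_le_of_lt h5] using h4 i h5
    · have : i = n := by omega
      subst this
      simpa [h3, ArcRel] using h1

lemma exists_cwalk {V : Type*} {E : Set (V × V)} (h : ¬ AcyclicArcs E) :
    ∃ n c, CWalk E n c := by
  simp only [AcyclicArcs, not_forall, not_not] at h
  obtain ⟨v, hv⟩ := h
  obtain ⟨w, h1, h2⟩ := TransGen.tail'_iff.1 hv
  obtain ⟨n, c, h3, h4, h5⟩ := walk_of_reflTransGen h1
  exact ⟨_, _, cwalk_mk n c h5 (by rw [h3, h4]; exact h2)⟩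

lemma no_cwalk {V : Type*} {A B : Set (V × V)} (hA : IsDAG A) (hV : Vertebrate A)
    (hS : StarP A) (hBA : B ⊆ A)
    (hcl : ∀ a b c, (a, b) ∈ B → (b, c) ∈ B → (a, c) ∈ A → (a, c) ∈ B)
    (hco : ∀ a b c, (a, b) ∈ A → (b, c) ∈ A → (a, c) ∈ B → (a, b) ∈ B ∨ (b, c) ∈ B) :
    ∀ n c, ¬ CWalk (reorient A B) n c := by
  obtain ⟨hl, hs, ac⟩ := hA
  have loop : ∀ a, (a, a) ∉ A := fun a h => hl _ h rfl
  have two : ∀ a b, (a, b) ∈ A → (b, a) ∉ A := fun a b h => hs _ h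
  have loopE : ∀ a, (a, a) ∉ reorient A B := by
    intro a h; rw [mem_reorient] at h
    rcases h with h | h
    · exact loop _ h.1
    · exact loop _ (hBA h)
  have twoE : ∀ a b, (a, b) ∈ reorient A B → (b, a) ∉ reorient A B := by
    intro a b h h'; rw [mem_reorient] at h h'
    have h1 := two a b
    have h2 := two b a
    have h3 := @hBA (a, b)
    have h4 := @hBA (b, a)
    tauto
  have adjE : ∀ a b, (a, b) ∈ reorient A B → (a, b) ∈ A ∨ (b, a) ∈ A := by
    intro a b h; rw [mem_reorient] at h
    exact h.imp (fun h => h.1) (fun h => hBA h)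
  have Eadj : ∀ a b, (a, b) ∈ A ∨ (b, a) ∈ A → (a, b) ∈ reorient A B ∨ (b, a) ∈ reorient A B := by
    intro a b h; rw [mem_reorient, mem_reorient]; tauto
  intro n
  induction n using Nat.strong_induction_on with
  | _ n ih =>
  rintro c ⟨hn, hper, hE⟩
  -- no shortcut
  have short : ∀ i j, i ≤ j → j - i + 1 < n → (c j, c i) ∉ reorient A B := by
    intro i j hij hlt hc
    refine ih _ hlt _ (cwalk_mk (j - i) (fun t => c (i + t)) (fun t _ => ?_) ?_)
    · exact hE _
    · simpa [Nat.add_sub_cancel' hij] using hc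
  have adjc : ∀ i j, i < j → j < i + n → ((c i, c j) ∈ A ∨ (c j, c i) ∈ A) →
      j = i + 1 ∨ j = i + n - 1 := by
    intro i j h1 h2 h3
    by_contra! hcon
    rcases Eadj _ _ h3 with h4 | h4
    · rw [← hper i] at h4
      exact short j (i + n) (by omega) (by omega) h4
    · exact short i j (by omega) (by omega) h4
  have inj : ∀ i j, i < j → j < i + n → c i ≠ c j := by
    intro i j h1 h2 h3
    have h4 := hE (j - 1)
    rw [Nat.sub_add_cancel (by omega), ← h3] at h4
    exact short i (j - 1) (by omega) (by omega) h4
  have n1 : n ≠ 1 := by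
    rintro rfl
    have := hE 0
    rw [hper 0] at this
    exact loopE _ this
  have n2 : n ≠ 2 := by
    rintro rfl
    have := hE 1
    rw [show 1 + 1 = 0 + 2 from rfl, hper 0] at this
    exact twoE _ _ (hE 0) this
  by_cases n3 : n = 3
  · subst n3
    have e0 := hE 0
    have e1 := hE 1
    have e2 := hE 2
    rw [show 2 + 1 = 0 + 3 from rfl, hper 0] at e2
    simp only [zero_add, Nat.reduceAdd] at e0 e1 e2
    rw [mem_reorient] at e0 e1 e2
    generalize c 0 = x at *
    generalize c 1 = y at *
    generalize c 2 = z at *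
    have cyc : ∀ a b d, (a, b) ∈ A → (b, d) ∈ A → (d, a) ∈ A → False := fun a b d p q r =>
      ac a (((TransGen.single p).tail q).tail r)
    rcases e0 with ⟨p1, p2⟩ | p1 <;> rcases e1 with ⟨q1, q2⟩ | q1 <;>
      rcases e2 with ⟨r1, r2⟩ | r1
    · exact cyc _ _ _ p1 q1 r1
    · have := hco _ _ _ p1 q1 r1; tauto
    · have := hco _ _ _ r1 p1 q1; tauto
    · exact p2 (hcl _ _ _ r1 q1 p1)
    · have := hco _ _ _ q1 r1 p1; tauto
    · exact q2 (hcl _ _ _ p1 r1 q1)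
    · exact r2 (hcl _ _ _ q1 p1 r1)
    · exact cyc _ _ _ (hBA q1) (hBA p1) (hBA r1)
  · set U : Set V := Set.range c with hU
    have rep : ∀ i, ∀ w ∈ U, ∃ l, i ≤ l ∧ l < i + n ∧ c l = w := by
      intro i w hw
      obtain ⟨k, rfl⟩ := hw
      have hm : ∀ q t, c (t + n * q) = c t := by
        intro q
        induction q with
        | zero => simp
        | succ q ihq => intro t; rw [Nat.mul_succ, ← add_assoc, hper, ihq]
      refine ⟨i + (k + n * i - i) % n, by omega, ?_, ?_⟩
      · have := Nat.mod_lt (k + n * i - i) hn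
        omega
      · rw [← hm ((k + n * i - i) / n)]
        have h1 := Nat.mod_add_div (k + n * i - i) n
        have h2 : i ≤ n * i := Nat.le_mul_of_pos_left _ hn
        rw [add_assoc, h1, Nat.add_sub_cancel' (by omega), hm]
    have red : ∀ i a b, (a = c i ∧ b = c (i + 1)) ∨ (a = c (i + 1) ∧ b = c i) → (a, b) ∈ A →
        (a, b) ∈ transRed (inducedArcs A U) := by
      intro i a b hab habA
      refine ⟨⟨habA, ?_, ?_⟩, ?_⟩
      · rcases hab with ⟨rfl, rfl⟩ | ⟨rfl, rfl⟩ <;> exact ⟨_, rfl⟩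
      · rcases hab with ⟨rfl, rfl⟩ | ⟨rfl, rfl⟩ <;> exact ⟨_, rfl⟩
      · rintro ⟨w, hw1, hw2⟩
        have haw : (a, w) ∈ A := hw1.1
        have hwb : (w, b) ∈ A := (hS a w b (.single haw) (transGen_induced hw2) habA).2
        obtain ⟨l, l1, l2, rfl⟩ := rep i w hw1.2.2
        have k1 : l ≠ i := by
          rintro rfl
          rcases hab with ⟨rfl, rfl⟩ | ⟨rfl, rfl⟩
          · exact loop _ haw
          · exact loop _ hwb
        have k2 : l ≠ i + 1 := by
          rintro rfl
          rcases hab with ⟨rfl, rfl⟩ | ⟨rfl, rfl⟩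
          · exact loop _ hwb
          · exact loop _ haw
        have k3 := adjc i l (by omega) (by omega) (by
          rcases hab with ⟨rfl, rfl⟩ | ⟨rfl, rfl⟩ <;> tauto)
        have k4 := adjc (i + 1) l (by omega) (by omega) (by
          rcases hab with ⟨rfl, rfl⟩ | ⟨rfl, rfl⟩ <;> tauto)
        omega
    have hac := hV U
    rw [IsForestArcs, SimpleGraph.isAcyclic_iff_forall_adj_isBridge] at hac
    have hadj : ∀ i, (undirectedGraph (transRed (inducedArcs A U))).Adj (c i) (c (i + 1)) := by
      intro i
      rw [adj_undirected]
      refine ⟨inj _ _ (by omega) (by omega), ?_⟩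
      exact (adjE _ _ (hE i)).imp (fun h => red i _ _ (by simp) h) (fun h => red i _ _ (by simp) h)
    have hb := hac (hadj 0)
    rw [SimpleGraph.isBridge_iff] at hb
    refine hb ?_
    have hr : ∀ i, i + 1 ≤ n → ((undirectedGraph (transRed (inducedArcs A U))).deleteEdges
        {s(c 0, c (0 + 1))}).Reachable (c (0 + 1)) (c (i + 1)) := by
      intro i
      induction i with
      | zero => intro _; exact SimpleGraph.Reachable.refl _
      | succ i ihi =>
        intro hi
        refine (ihi (by omega)).trans (SimpleGraph.Adj.reachable ?_)
        rw [SimpleGraph.deleteEdges_adj]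
        refine ⟨hadj _, ?_⟩
        have q1 := inj 0 (i + 1) (by omega) (by omega)
        simp only [Set.mem_singleton_iff, Sym2.eq_iff, zero_add]
        rintro (⟨q3, _⟩ | ⟨q3, q4⟩)
        · exact q1 q3.symm
        · by_cases hin : i = 0
          · subst hin
            exact inj 0 2 (by omega) (by omega) q4.symm
          · exact inj 1 (i + 1) (by omega) (by omega) q3.symm
    have := hr (n - 1) (by omega)
    rw [Nat.sub_add_cancel (by omega)] at this
    have h0 : c n = c 0 := by simpa using hper 0
    rw [h0] at this
    exact this.symm

lemma mem_of_biclosed {V : Type*} {A B : Set (V × V)} (hA : IsDAG A) (hV : Vertebrate A)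
    (hS : StarP A) (hBA : B ⊆ A)
    (hcl : ∀ a b c, (a, b) ∈ B → (b, c) ∈ B → (a, c) ∈ A → (a, c) ∈ B)
    (hco : ∀ a b c, (a, b) ∈ A → (b, c) ∈ A → (a, c) ∈ B → (a, b) ∈ B ∨ (b, c) ∈ B) :
    ARmem A B := by
  refine ⟨hBA, ?_⟩
  by_contra h
  obtain ⟨n, c, h⟩ := exists_cwalk h
  exact no_cwalk hA hV hS hBA hcl hco n c h

/-- transitive closure within `A` -/
def clo {V : Type*} (A S : Set (V × V)) : Set (V × V) :=
  {a ∈ A | TransGen (ArcRel S) a.1 a.2}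

lemma clo_mem {V : Type*} {A B C : Set (V × V)} (hA : IsDAG A) (hV : Vertebrate A)
    (hS : StarP A) (hB : ARmem A B) (hC : ARmem A C) : ARmem A (clo A (B ∪ C)) := by
  refine mem_of_biclosed hA hV hS (fun a h => h.1) ?_ ?_
  · intro a b c h1 h2 h3
    exact ⟨h3, h1.2.trans h2.2⟩
  · intro u w v h1 h2 h3
    obtain ⟨huv, hT⟩ := h3
    simp only at hT
    have hsub : ∀ a b, TransGen (ArcRel (B ∪ C)) a b → TransGen (ArcRel A) a b :=
      TransGen.mono (fun _ _ h => h.elim (fun h => hB.1 h) (fun h => hC.1 h))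
    have coc : ∀ a b c, (a, b) ∈ A → (b, c) ∈ A → (a, c) ∈ B ∪ C →
        (a, b) ∈ B ∪ C ∨ (b, c) ∈ B ∪ C := by
      rintro a b c p q (r | r)
      · exact (tri_coclosed hB p q r).imp Or.inl Or.inl
      · exact (tri_coclosed hC p q r).imp Or.inr Or.inr
    suffices hmain : TransGen (ArcRel (B ∪ C)) u w ∨ TransGen (ArcRel (B ∪ C)) w v from
      hmain.imp (fun h => ⟨h1, h⟩) (fun h => ⟨h2, h⟩)
    induction hT using TransGen.head_induction_on with
    | single h => exact (coc _ _ _ h1 h2 h).imp .single .single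
    | @head u x hux hxv ih =>
      have huxA : (u, x) ∈ A := hux.elim (fun h => hB.1 h) (fun h => hC.1 h)
      have hxvA : (x, v) ∈ A := (hS u x v (.single huxA) (hsub _ _ hxv) huv).2
      rcases no_diamond hA hV huxA hxvA h1 h2 with rfl | h | h
      · exact Or.inl (.single hux)
      · exact (ih h hxvA).imp (fun h' => TransGen.head hux h') id
      · rcases coc _ _ _ h1 h hux with h' | h'
        · exact Or.inl (.single h')
        · exact Or.inr (TransGen.head h' hxv)

lemma clo_least {V : Type*} {A S C : Set (V × V)} (hC : ARmem A C) (h : S ⊆ C) :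
    clo A S ⊆ C := by
  rintro ⟨u, v⟩ ⟨h1, h2⟩
  by_contra h3
  have h4 : TransGen (ArcRel (reorient A C)) v u := by
    rw [← transGen_swap]
    refine TransGen.mono (fun x y hxy => ?_) _ _ h2
    exact mem_reorient.2 (Or.inr (h hxy))
  exact hC.2 v (h4.tail (mem_reorient.2 (Or.inl ⟨h1, h3⟩)))

lemma subset_clo {V : Type*} {A S : Set (V × V)} (h : S ⊆ A) : S ⊆ clo A S :=
  fun _ ha => ⟨h ha, .single ha⟩

lemma isLUB_clo {V : Type*} {A : Set (V × V)} (hA : IsDAG A) (hV : Vertebrate A)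
    (hS : StarP A) (x y : ARP A) :
    IsLUB {x, y} (⟨clo A (x.1 ∪ y.1), clo_mem hA hV hS x.2 y.2⟩ : ARP A) := by
  have hs := subset_clo (Set.union_subset x.2.1 y.2.1)
  constructor
  · rintro z (rfl | rfl)
    · exact Set.subset_union_left.trans hs
    · exact Set.subset_union_right.trans hs
  · intro z hz
    exact clo_least z.2 (Set.union_subset (hz (Or.inl rfl)) (hz (Or.inr rfl)))

lemma exists_rank {V : Type*} [Fintype V] {A : Set (V × V)} (hA : AcyclicArcs A) :
    ∃ f : V → ℕ, ∀ a b, (a, b) ∈ A → f a < f b := by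
  refine ⟨fun a => {w | TransGen (ArcRel A) w a}.ncard, fun a b hab => ?_⟩
  refine Set.ncard_lt_ncard ⟨fun w hw => hw.tail hab, fun h => ?_⟩ (Set.toFinite _)
  exact hA a (h (TransGen.single hab))

lemma join_sd {V : Type*} [Fintype V] {A x y z w x' : Set (V × V)} (hA : IsDAG A)
    (hS : StarP A) (hx' : ARmem A x') (hy : ARmem A y) (hz : ARmem A z) (hxA : x ⊆ A)
    (hj : clo A (x ∪ y) = clo A (x ∪ z)) (hw : w = A \ clo A ((A \ y) ∪ (A \ z)))
    (hxx' : x ⊆ x') (hwx' : w ⊆ x') : clo A (x ∪ y) ⊆ x' := by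
  obtain ⟨f, hf⟩ := exists_rank hA.2.2
  set j := clo A (x ∪ y) with hjd
  have hjA : j ⊆ A := fun a h => h.1
  have hxyj : x ∪ y ⊆ j := subset_clo (Set.union_subset hxA hy.1)
  have hxzj : x ∪ z ⊆ j := hj ▸ subset_clo (Set.union_subset hxA hz.1)
  suffices H : ∀ n u v, f v - f u = n → (u, v) ∈ j → (u, v) ∈ x' by
    rintro ⟨u, v⟩ h; exact H _ u v rfl h
  intro n
  induction n using Nat.strong_induction_on with
  | _ n ih =>
  intro u v hn huv
  by_contra hnx
  have huvA := hjA huv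
  have ihu : ∀ t, (u, t) ∈ A → (t, v) ∈ A → (u, t) ∈ j → (u, t) ∈ x' := by
    intro t h1 h2 h3
    have := hf _ _ h1
    have := hf _ _ h2
    exact ih _ (by omega) u t rfl h3
  have ihv : ∀ t, (u, t) ∈ A → (t, v) ∈ A → (t, v) ∈ j → (t, v) ∈ x' := by
    intro t h1 h2 h3
    have := hf _ _ h1
    have := hf _ _ h2
    exact ih _ (by omega) t v rfl h3
  -- the arc lies in y and z
  have inYZ : ∀ s, s ⊆ A → x ∪ s ⊆ j → (u, v) ∈ clo A (x ∪ s) → (u, v) ∈ s := by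
    intro s hsA hsj huvs
    have hT := huvs.2
    simp only at hT
    have hsub : ∀ a b, TransGen (ArcRel (x ∪ s)) a b → TransGen (ArcRel A) a b :=
      TransGen.mono (fun _ _ h => h.elim (fun h => hxA h) (fun h => hsA h))
    rcases TransGen.head'_iff.1 hT with ⟨t, h1, h2⟩
    rcases reflTransGen_iff_eq_or_transGen.1 h2 with rfl | h3
    · rcases h1 with h1 | h1
      · exact absurd (hxx' h1) hnx
      · exact h1
    · exfalso
      have h1A := hjA (hsj h1)
      have h3A : (t, v) ∈ A := (hS u t v (.single h1A) (hsub _ _ h3) huvA).2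
      have h3j : (t, v) ∈ j := by
        have h5 : (t, v) ∈ clo A (x ∪ s) := ⟨h3A, h3⟩
        refine ⟨h3A, ?_⟩
        have h6 : ∀ a b, (a, b) ∈ x ∪ s → TransGen (ArcRel (x ∪ y)) a b :=
          fun a b h => (hsj h).2
        exact TransGen.lift' id (fun a b h => h6 a b h) _ _ h3
      exact hnx (tri_closed hx' (ihu t h1A h3A (hsj h1)) (ihv t h1A h3A h3j) huvA)
  have huy := inYZ y hy.1 hxyj huv
  have huz := inYZ z hz.1 hxzj (hj ▸ huv)
  have huw : (u, v) ∉ w := fun h => hnx (hwx' h)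
  have hT : TransGen (ArcRel ((A \ y) ∪ (A \ z))) u v := by
    by_contra hT
    exact huw (hw ▸ ⟨huvA, fun h => hT h.2⟩)
  have hyj : y ⊆ j := Set.subset_union_right.trans hxyj
  have hzj : z ⊆ j := Set.subset_union_right.trans hxzj
  have key : ∀ t, (u, t) ∈ A → (t, v) ∈ A → ((u, t) ∉ y ∨ (u, t) ∉ z) → (u, t) ∉ j := by
    intro t h1 h2 h3 h4
    have h5 : (t, v) ∈ j := by
      rcases h3 with h3 | h3
      · exact hyj ((tri_coclosed hy h1 h2 huy).resolve_left h3)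
      · exact hzj ((tri_coclosed hz h1 h2 huz).resolve_left h3)
    exact hnx (tri_closed hx' (ihu t h1 h2 h4) (ihv t h1 h2 h5) huvA)
  have SA : ∀ a b, (a, b) ∈ (A \ y) ∪ (A \ z) → (a, b) ∈ A := fun a b h => h.elim (·.1) (·.1)
  have hsub : ∀ a b, TransGen (ArcRel ((A \ y) ∪ (A \ z))) a b → TransGen (ArcRel A) a b :=
    TransGen.mono (fun _ _ h => SA _ _ h)
  have walk : ∀ t, TransGen (ArcRel ((A \ y) ∪ (A \ z))) u t → TransGen (ArcRel A) t v →
      (u, t) ∉ j := by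
    intro t ht
    induction ht with
    | single h =>
      intro h2
      have hA1 := SA _ _ h
      exact key _ hA1 (hS _ _ _ (.single hA1) h2 huvA).2 (h.imp (·.2) (·.2))
    | @tail s t hs hst ihs =>
      intro h2
      have h3 := ihs (TransGen.head (SA _ _ hst) h2)
      obtain ⟨h4, h5⟩ := hS u t v ((hsub _ _ hs).tail (SA _ _ hst)) h2 huvA
      have h6 := (hS u s v (hsub _ _ hs) (TransGen.head (SA _ _ hst) h2) huvA).1
      refine key t h4 h5 ?_
      rcases hst with hst | hst
      · left; intro h7
        rcases tri_coclosed hy h6 hst.1 h7 with h8 | h8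
        · exact h3 (hyj h8)
        · exact hst.2 h8
      · right; intro h7
        rcases tri_coclosed hz h6 hst.1 h7 with h8 | h8
        · exact h3 (hzj h8)
        · exact hst.2 h8
  cases hT with
  | single h => rcases h with h | h
                · exact h.2 huy
                · exact h.2 huz
  | @tail t _ h1 h2 =>
    have h3 := walk t h1 (.single (SA _ _ h2))
    have h6 := (hS u t v (hsub _ _ h1) (.single (SA _ _ h2)) huvA).1
    rcases h2 with hst | hst
    · rcases tri_coclosed hy h6 hst.1 huy with h8 | h8
      · exact h3 (hyj h8)
      · exact hst.2 h8
    · rcases tri_coclosed hz h6 hst.1 huz with h8 | h8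
      · exact h3 (hzj h8)
      · exact hst.2 h8

lemma skeletal_imp {V : Type*} [Fintype V] {A : Set (V × V)} (hA : IsDAG A) (hV : Vertebrate A)
    (hS : StarP A) :
    ((∀ x y : ARP A, ∃ z : ARP A, IsLUB {x, y} z) ∧
      (∀ x y : ARP A, ∃ z : ARP A, IsGLB {x, y} z) ∧
      (∀ x y z j yz : ARP A,
        IsLUB {x, y} j → IsLUB {x, z} j → IsGLB {y, z} yz → IsLUB {x, yz} j) ∧
      (∀ x y z m yz : ARP A,
        IsGLB {x, y} m → IsGLB {x, z} m → IsLUB {y, z} yz → IsGLB {x, yz} m)) := by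
  have hlub : ∀ x y : ARP A, ∃ z : ARP A, IsLUB {x, y} z := fun x y => ⟨_, isLUB_clo hA hV hS x y⟩
  have hsd : ∀ x y z j yz : ARP A,
        IsLUB {x, y} j → IsLUB {x, z} j → IsGLB {y, z} yz → IsLUB {x, yz} j := by
    intro x y z j yz h1 h2 h3
    have e1 := h1.unique (isLUB_clo hA hV hS x y)
    have e2 := h2.unique (isLUB_clo hA hV hS x z)
    have e3 := (isLUB_co.2 h3).unique (isLUB_clo hA hV hS (co y) (co z))
    have e4 : yz.1 = A \ clo A ((A \ y.1) ∪ (A \ z.1)) := by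
      rw [← co_co yz, e3]; rfl
    have hl := isLUB_clo hA hV hS x yz
    set x' : ARP A := ⟨clo A (x.1 ∪ yz.1), clo_mem hA hV hS x.2 yz.2⟩
    have hle : j ≤ x' := by
      have := join_sd (x := x.1) (y := y.1) (z := z.1) (w := yz.1) (x' := x'.1) hA hS x'.2
        y.2 z.2 x.2.1 (by simpa using congrArg Subtype.val (e1.symm.trans e2)) e4
        (hl.1 (Or.inl rfl)) (hl.1 (Or.inr rfl))
      rw [e1]; exact this
    have hge : x' ≤ j := by
      refine hl.2 ?_
      rintro t (rfl | rfl)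
      · exact h1.1 (Or.inl rfl)
      · exact le_trans (h3.1 (Or.inl rfl)) (h1.1 (Or.inr rfl))
    rw [le_antisymm hle hge]; exact hl
  refine ⟨hlub, ?_, hsd, ?_⟩
  · intro x y
    obtain ⟨z, hz⟩ := hlub (co x) (co y)
    refine ⟨co z, ?_⟩
    rw [← isLUB_co, co_co]; exact hz
  · intro x y z m yz h1 h2 h3
    rw [← isLUB_co] at h1 h2 ⊢
    refine hsd _ _ _ _ _ h1 h2 ?_
    rw [← isLUB_co]; simpa [co_co] using h3

open Classical in
/-- rank function swapping exactly one arc of the transitive reduction -/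
noncomputable def gfun {V : Type*} (A : Set (V × V)) (U : Set V) (k : ℕ) (p q : V) (w : V) : ℕ :=
  if w ∉ U then k else if w = q then 2 else if w = p then 3 else
    if TransGen (ArcRel (inducedArcs A U)) w q then 1 else 4

lemma gfun_arc {V : Type*} {A : Set (V × V)} (hA : IsDAG A) {U : Set V} {k : ℕ} {p q a b : V}
    (hpq : (p, q) ∈ transRed (inducedArcs A U)) (haU : a ∈ U) (hbU : b ∈ U) (hab : (a, b) ∈ A)
    (h : gfun A U k p q b < gfun A U k p q a) : (a, b) = (p, q) := by
  have ha' : ArcRel (inducedArcs A U) a b := ⟨hab, haU, hbU⟩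
  have hpq' : ArcRel (inducedArcs A U) p q := hpq.1
  have f1 : TransGen (ArcRel (inducedArcs A U)) b q → TransGen (ArcRel (inducedArcs A U)) a q :=
    fun h => TransGen.head ha' h
  have f2 : b = q → TransGen (ArcRel (inducedArcs A U)) a q := by
    rintro rfl; exact .single ha'
  have f3 : b = p → TransGen (ArcRel (inducedArcs A U)) b q := by
    rintro rfl; exact .single hpq'
  have f4 : a = q → ¬ TransGen (ArcRel (inducedArcs A U)) b q := by
    rintro rfl h; exact hA.2.2 _ (transGen_induced (TransGen.head ha' h))
  have f5 : a = p → ¬ TransGen (ArcRel (inducedArcs A U)) b q := by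
    rintro rfl h
    exact hpq.2 ⟨b, ha', h⟩
  have f6 : ¬ TransGen (ArcRel (inducedArcs A U)) q q := fun h => hA.2.2 _ (transGen_induced h)
  simp only [gfun, haU, hbU, not_true_eq_false, if_false] at h
  grind

lemma gfun_self {V : Type*} {A : Set (V × V)} (hA : IsDAG A) {U : Set V} {k : ℕ} {p q : V}
    (hpq : (p, q) ∈ transRed (inducedArcs A U)) :
    (p, q) ∈ rankSet A (gfun A U k p q) := by
  refine ⟨hpq.1.1, ?_⟩
  have hne : p ≠ q := hA.1 _ hpq.1.1
  have h1 : p ∈ U := hpq.1.2.1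
  have h2 : q ∈ U := hpq.1.2.2
  simp [gfun, h1, h2, hne]

lemma exists_lub_finite {V : Type*} {A : Set (V × V)} (hA : IsDAG A)
    (h : ∀ x y : ARP A, ∃ z : ARP A, IsLUB {x, y} z) (s : Set (ARP A)) (hs : s.Finite) :
    ∃ z, IsLUB s z := by
  induction s, hs using Set.Finite.induction_on with
  | empty =>
    refine ⟨⟨_, rankSet_mem hA (fun _ => 0)⟩, by simp [upperBounds], fun z _ => ?_⟩
    rintro a ⟨_, ha⟩
    simp at ha
  | @insert a s _ _ ih =>
    obtain ⟨z, hz⟩ := ih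
    obtain ⟨t, ht⟩ := h a z
    refine ⟨t, ?_, ?_⟩
    · rintro b (rfl | hb)
      · exact ht.1 (Or.inl rfl)
      · exact (hz.1 hb).trans (ht.1 (Or.inr rfl))
    · intro b hb
      refine ht.2 ?_
      rintro c (rfl | rfl)
      · exact hb (Or.inl rfl)
      · exact hz.2 (fun d hd => hb (Or.inr hd))

lemma walk_rev {V : Type*} {G : SimpleGraph V} {r : V → V → Prop} {a b : V} (p : G.Walk a b)
    (h : ∀ d ∈ p.darts, r d.snd d.fst) : ReflTransGen r b a := by
  induction p with
  | nil => exact .refl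
  | cons h1 p ih =>
    simp only [SimpleGraph.Walk.darts_cons, List.mem_cons, forall_eq_or_imp] at h
    exact (ih h.2).tail h.1

lemma lattice_vertebrate {V : Type*} [Fintype V] {A : Set (V × V)} (hA : IsDAG A)
    (h : ∀ x y : ARP A, ∃ z : ARP A, IsLUB {x, y} z) : Vertebrate A := by
  intro U a c hc
  let T := transRed (inducedArcs A U)
  let atom : V → V → ARP A := fun p q => ⟨_, rankSet_mem hA (gfun A U 0 p q)⟩
  let coat : V → V → ARP A := fun p q => co ⟨_, rankSet_mem hA (gfun A U 5 p q)⟩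
  obtain ⟨J, hJ⟩ := exists_lub_finite hA h
    {z | ∃ d ∈ c.darts, (d.fst, d.snd) ∈ T ∧ z = atom d.fst d.snd} (Set.toFinite _)
  have key : ∀ d ∈ c.darts, ArcRel (reorient A J.1) d.snd d.fst := by
    intro d hd
    obtain ⟨hne, h1 | h1⟩ := adj_undirected.1 d.adj
    · exact mem_reorient.2 (Or.inr (hJ.1 ⟨d, hd, h1, rfl⟩ (gfun_self hA h1)))
    · refine mem_reorient.2 (Or.inl ⟨h1.1.1, fun hmem => ?_⟩)
      have hle : J ≤ coat d.snd d.fst := by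
        refine hJ.2 ?_
        rintro z ⟨d', hd', h2, rfl⟩
        rintro ⟨s, t⟩ ⟨hst, hg⟩
        refine ⟨hst, fun hco => ?_⟩
        have hg2 := hco.2
        simp only at hg hg2
        have htU : t ∈ U := by
          by_contra htU
          have e5 : gfun A U 5 d.snd d.fst t = 5 := by simp [gfun, htU]
          have : ∀ w, gfun A U 5 d.snd d.fst w ≤ 5 := by
            intro w; unfold gfun; split_ifs <;> omega
          have := this s
          omega
        have hsU : s ∈ U := by
          by_contra hsU
          have e5 : gfun A U 0 d'.fst d'.snd s = 0 := by simp [gfun, hsU]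
          omega
        have e1 := gfun_arc hA h2 hsU htU hst hg
        have e2 := gfun_arc hA h1 hsU htU hst hg2
        have e3 := e1.symm.trans e2
        have hedge : d'.edge = d.edge := by
          simp only [Prod.mk.injEq] at e3
          change s(d'.fst, d'.snd) = s(d.fst, d.snd)
          rw [e3.1, e3.2, Sym2.eq_swap]
        have hnd := hc.edges_nodup
        have heq := List.inj_on_of_nodup_map hnd hd' hd hedge
        subst heq
        simp only [Prod.mk.injEq] at e3
        exact hne e3.1
      exact (hle hmem).2 (gfun_self hA h1)
  cases c with
  | nil => exact hc.ne_nil rfl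
  | cons h1 p =>
    simp only [SimpleGraph.Walk.darts_cons, List.mem_cons, forall_eq_or_imp] at key
    have h2 := walk_rev p key.2
    exact J.2.2 _ (TransGen.tail' h2 key.1)

lemma isLUB_of_union {V : Type*} {A : Set (V × V)} {x y b : ARP A} (h : b.1 = x.1 ∪ y.1) :
    IsLUB {x, y} b := by
  constructor
  · rintro z (rfl | rfl)
    · change _ ⊆ b.1; rw [h]; exact Set.subset_union_left
    · change _ ⊆ b.1; rw [h]; exact Set.subset_union_right
  · intro z hz
    change b.1 ⊆ z.1
    rw [h]
    exact Set.union_subset (hz (Or.inl rfl)) (hz (Or.inr rfl))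

lemma rankSet_union {V : Type*} {A : Set (V × V)} {f g h : V → ℕ}
    (H : ∀ s t, (s, t) ∈ A → (f t < f s ↔ g t < g s ∨ h t < h s)) :
    rankSet A f = rankSet A g ∪ rankSet A h := by
  ext ⟨s, t⟩
  simp only [rankSet, Set.mem_ofPred_eq, Set.mem_union]
  have := H s t
  tauto

open Classical in
lemma exists_gx {V : Type*} (A : Set (V × V)) (u m v : V) (Dn Up : V → Prop) (hDu : Dn u)
    (hUv : Up v) (hDm : ¬ Dn m) (hUm : ¬ Up m) (hDU : ∀ w, Dn w → ¬ Up w)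
    (hv1 : ∀ t, (v, t) ∈ A → ¬ Up t ∧ ¬ Dn t ∧ t ≠ m)
    (hu1 : ∀ s, (s, u) ∈ A → ¬ Up s ∧ ¬ Dn s ∧ s ≠ m)
    (hUD : ∀ s t, (s, t) ∈ A → (Up s ∨ s = m) → ¬ (Dn t ∨ t = m))
    (huv : (u, v) ∈ A) (hcon : ¬ ((u, m) ∈ A ∧ (m, v) ∈ A)) :
    let gy : V → ℕ := fun w => if Up w ∨ w = m then 1 else if Dn w then 2 else 0
    let gz : V → ℕ := fun w => if Up w then 1 else if w = m ∨ Dn w then 2 else 0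
    let gb : V → ℕ := fun w => if Up w then 1 else if w = m then 2 else if Dn w then 3 else 0
    ∃ gx : V → ℕ,
      (∀ s t, (s, t) ∈ A → (gb t < gb s ↔ gx t < gx s ∨ gy t < gy s)) ∧
      (∀ s t, (s, t) ∈ A → (gb t < gb s ↔ gx t < gx s ∨ gz t < gz s)) ∧
      ¬ gx v < gx u ∧
      ∀ s t, (s, t) ∈ A → gb t < gb s → (s, t) ≠ (u, v) → gx t < gx s := by
  intro gy gz gb
  by_cases hc : (m, v) ∈ A
  · have hc' : (u, m) ∉ A := by tauto
    refine ⟨fun w => if w = u then 2 else if w = v then 3 else if w = m then 4 else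
      if Up w then 1 else if Dn w then 5 else 0, ?_, ?_, ?_, ?_⟩
    · intro s t hst
      have := hv1 t
      have := hu1 s
      have := hUD s t hst
      simp only [gb, gy]
      grind (splits := 25)
    · intro s t hst
      have := hv1 t
      have := hu1 s
      have := hUD s t hst
      simp only [gb, gz]
      grind (splits := 25)
    · grind (splits := 25)
    · intro s t hst
      have := hv1 t
      have := hu1 s
      have := hUD s t hst
      simp only [gb]
      grind (splits := 25)
  · refine ⟨fun w => if w = v then 4 else if w = u then 3 else if w = m then 2 else
      if Up w then 1 else if Dn w then 5 else 0, ?_, ?_, ?_, ?_⟩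
    · intro s t hst
      have := hv1 t
      have := hu1 s
      have := hUD s t hst
      simp only [gb, gy]
      grind (splits := 25)
    · intro s t hst
      have := hv1 t
      have := hu1 s
      have := hUD s t hst
      simp only [gb, gz]
      grind (splits := 25)
    · grind (splits := 25)
    · intro s t hst
      have := hv1 t
      have := hu1 s
      have := hUD s t hst
      simp only [gb]
      grind (splits := 25)

open Classical in
lemma sd_star {V : Type*} {A : Set (V × V)} (hA : IsDAG A)
    (hm : ∀ x y : ARP A, ∃ z : ARP A, IsGLB {x, y} z)
    (hsd : ∀ x y z j yz : ARP A,
        IsLUB {x, y} j → IsLUB {x, z} j → IsGLB {y, z} yz → IsLUB {x, yz} j) : StarP A := by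
  intro u m v hum hmv huv
  by_contra hcon
  have ac := hA.2.2
  let T := TransGen (ArcRel A)
  let Dn : V → Prop := fun w => (w = u ∨ T u w) ∧ T w m
  let Up : V → Prop := fun w => (w = v ∨ T w v) ∧ T m w
  have hDu : Dn u := ⟨Or.inl rfl, hum⟩
  have hUv : Up v := ⟨Or.inl rfl, hmv⟩
  have hDm : ¬ Dn m := fun h => ac _ h.2
  have hUm : ¬ Up m := fun h => ac _ h.2
  have hDU : ∀ w, Dn w → ¬ Up w := fun w h1 h2 => ac _ (h1.2.trans h2.2)
  -- arcs out of v and into u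
  have hv1 : ∀ t, (v, t) ∈ A → ¬ Up t ∧ ¬ Dn t ∧ t ≠ m := by
    intro t ht
    refine ⟨fun h => ?_, fun h => ?_, ?_⟩
    · rcases h.1 with rfl | h1
      · exact ac _ (.single ht)
      · exact ac _ (TransGen.head ht h1)
    · exact ac _ ((TransGen.head ht h.2).trans hmv)
    · rintro rfl; exact ac _ (TransGen.head ht hmv)
  have hu1 : ∀ s, (s, u) ∈ A → ¬ Up s ∧ ¬ Dn s ∧ s ≠ m := by
    intro s hs
    refine ⟨fun h => ?_, fun h => ?_, ?_⟩
    · exact ac _ ((h.2.tail hs).trans hum)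
    · rcases h.1 with rfl | h1
      · exact ac _ (.single hs)
      · exact ac _ (h1.tail hs)
    · rintro rfl; exact ac _ (hum.tail hs)
  -- arcs not increasing
  have hUD : ∀ s t, (s, t) ∈ A → (Up s ∨ s = m) → ¬ (Dn t ∨ t = m) := by
    intro s t hst h1 h2
    have a1 : ReflTransGen (ArcRel A) m s := by
      rcases h1 with h1 | rfl
      · exact h1.2.to_reflTransGen
      · exact .refl
    have a2 : ReflTransGen (ArcRel A) t m := by
      rcases h2 with h2 | rfl
      · exact h2.2.to_reflTransGen
      · exact .refl
    exact ac m ((TransGen.tail' a1 hst).trans_left a2)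
  let gy : V → ℕ := fun w => if Up w ∨ w = m then 1 else if Dn w then 2 else 0
  let gz : V → ℕ := fun w => if Up w then 1 else if w = m ∨ Dn w then 2 else 0
  let gb : V → ℕ := fun w => if Up w then 1 else if w = m then 2 else if Dn w then 3 else 0
  obtain ⟨gx, hxy, hxz, hxe, hxb⟩ : ∃ gx : V → ℕ,
      (∀ s t, (s, t) ∈ A → (gb t < gb s ↔ gx t < gx s ∨ gy t < gy s)) ∧
      (∀ s t, (s, t) ∈ A → (gb t < gb s ↔ gx t < gx s ∨ gz t < gz s)) ∧
      ¬ gx v < gx u ∧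
      ∀ s t, (s, t) ∈ A → gb t < gb s → (s, t) ≠ (u, v) → gx t < gx s := by
    have hh := exists_gx A u m v Dn Up hDu hUv hDm hUm hDU hv1 hu1 hUD huv hcon
    convert hh <;> (simp only [gy, gz, gb]; congr)
  let x : ARP A := ⟨_, rankSet_mem hA gx⟩
  let y : ARP A := ⟨_, rankSet_mem hA gy⟩
  let z : ARP A := ⟨_, rankSet_mem hA gz⟩
  let b : ARP A := ⟨_, rankSet_mem hA gb⟩
  have e1 : b.1 = x.1 ∪ y.1 := rankSet_union hxy
  have e2 : b.1 = x.1 ∪ z.1 := rankSet_union hxz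
  obtain ⟨w, hw⟩ := hm y z
  have hl := hsd x y z b w (isLUB_of_union e1) (isLUB_of_union e2) hw
  have hwy : w.1 ⊆ y.1 := hw.1 (Or.inl rfl)
  have hwz : w.1 ⊆ z.1 := hw.1 (Or.inr rfl)
  have heb : (u, v) ∈ b.1 := by
    refine ⟨huv, ?_⟩
    have := hDU u hDu
    have : u ≠ m := by rintro rfl; exact hDm hDu
    simp [gb, *]
  have hex : (u, v) ∉ x.1 := fun h => hxe h.2
  by_cases hew : (u, v) ∈ w.1
  · -- the path avoids `w`
    have p1 : ∀ s t, (s, t) ∈ A → (s = u ∨ T u s) → (t = m ∨ T t m) → (s, t) ∉ w.1 := by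
      intro s t hst h1 h2 h3
      have h4 := (hwz h3).2
      have hs : Dn s := by
        refine ⟨h1, ?_⟩
        rcases h2 with rfl | h2
        · exact .single hst
        · exact TransGen.head hst h2
      have ht : t = m ∨ Dn t := by
        rcases h2 with h2 | h2
        · exact Or.inl h2
        · right
          refine ⟨Or.inr ?_, h2⟩
          rcases h1 with rfl | h1
          · exact .single hst
          · exact h1.tail hst
      have a1 := hDU s hs
      have a2 : ¬ Up t := by
        rcases ht with rfl | ht
        · exact hUm
        · exact hDU _ ht
      simp [gz, a1, a2, hs, ht] at h4
    have p2 : ∀ s t, (s, t) ∈ A → (s = m ∨ T m s) → (t = v ∨ T t v) → (s, t) ∉ w.1 := by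
      intro s t hst h1 h2 h3
      have h4 := (hwy h3).2
      have ht : Up t := by
        refine ⟨h2, ?_⟩
        rcases h1 with rfl | h1
        · exact .single hst
        · exact h1.tail hst
      have hs : Up s ∨ s = m := by
        rcases h1 with h1 | h1
        · exact Or.inr h1
        · left
          refine ⟨Or.inr ?_, h1⟩
          rcases h2 with rfl | h2
          · exact .single hst
          · exact TransGen.head hst h2
      simp [gy, hs, ht] at h4
    have q : ∀ a c, (∀ s t, (s, t) ∈ A → (s = a ∨ T a s) → (t = c ∨ T t c) → (s, t) ∉ w.1) →
        ∀ t, T a t → (t = c ∨ T t c) → TransGen (ArcRel (reorient A w.1)) a t := by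
      intro a c hp t ht
      induction ht with
      | single h1 =>
        intro h2
        exact .single (mem_reorient.2 (Or.inl ⟨h1, hp _ _ h1 (Or.inl rfl) h2⟩))
      | @tail s t h0 h1 ih =>
        intro h2
        refine (ih (Or.inr ?_)).tail (mem_reorient.2 (Or.inl ⟨h1, hp _ _ h1 (Or.inr h0) h2⟩))
        rcases h2 with rfl | h2
        · exact .single h1
        · exact TransGen.head h1 h2
    have r1 := q u m p1 m hum (Or.inl rfl)
    have r2 := q m v p2 v hmv (Or.inl rfl)
    exact w.2.2 u ((r1.trans r2).tail (mem_reorient.2 (Or.inr hew)))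
  · have hwx : w.1 ⊆ x.1 := by
      rintro ⟨s, t⟩ ha
      have h1 : (s, t) ∈ b.1 := by rw [e1]; exact Or.inr (hwy ha)
      exact ⟨h1.1, hxb s t h1.1 h1.2 (fun h => hew (h ▸ ha))⟩
    have hbx : b ≤ x := by
      refine hl.2 ?_
      rintro t (rfl | rfl)
      · exact le_rfl
      · exact hwx
    exact hex (hbx heb)
end RelSection

/-- The acyclic reorientation poset is a semidistributive
lattice if and only if `D` is skeletal. -/
theorem stmt_12 {V : Type*} [Fintype V] (A : Set (V × V)) (hA : IsDAG A) :
    ((∀ x y : ARP A, ∃ z : ARP A, IsLUB {x, y} z) ∧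
      (∀ x y : ARP A, ∃ z : ARP A, IsGLB {x, y} z) ∧
      (∀ x y z j yz : ARP A,
        IsLUB {x, y} j → IsLUB {x, z} j → IsGLB {y, z} yz → IsLUB {x, yz} j) ∧
      (∀ x y z m yz : ARP A,
        IsGLB {x, y} m → IsGLB {x, z} m → IsLUB {y, z} yz → IsGLB {x, yz} m)) ↔
    Skeletal A := by

  constructor
  · rintro ⟨h1, h2, h3, _⟩
    exact ⟨lattice_vertebrate hA h1, starP_filled (sd_star hA h2 h3)⟩
  · rintro ⟨h1, h2⟩
    exact skeletal_imp hA h1 (filled_star hA h2)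
end
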